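/- arXiv:1511.07253 — 2 statements merged into one kernel-verified Lean document; each statement's English description precedes it below -/
import Mathlib

section
/- Let q be an odd prime and N ≥ 3 odd. If S is a maximal partial line spread of PG(N,q) of deficiency δ > 0, i.e. |S| = (q^{N+1}−1)/(q^2−1) − δ with δ > 0, then δ ≥ (q+3)/2. -/
/-- A partial line spread of PG(n-1, q): a set of lines (2-dimensional linear
subspaces of `F^n`) that are pairwise skew, i.e. pairwise intersecting only
in the zero subspace. -/
def IsPartialLineSpread (F : Type*) [Field F] (n : ℕ)
    (S : Set (Submodule F (Fin n → F))) : Prop :=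
  (∀ l ∈ S, Module.finrank F ↥l = 2) ∧
  (∀ l ∈ S, ∀ l' ∈ S, l ≠ l' → l ⊓ l' = ⊥)

/-- A maximal partial line spread: a partial line spread such that every line
of the space meets some line of the spread nontrivially (equivalently, it
cannot be extended to a larger partial line spread). -/
def IsMaximalPartialLineSpread (F : Type*) [Field F] (n : ℕ)
    (S : Set (Submodule F (Fin n → F))) : Prop :=
  IsPartialLineSpread F n S ∧
  ∀ m : Submodule F (Fin n → F), Module.finrank F ↥m = 2 → ∃ l ∈ S, m ⊓ l ≠ ⊥

open Polynomial in
theorem exists_pow_dvd_of_lacunary {F ι : Type*} [Field F] {p : ℕ} [Fact p.Prime] [CharP F p]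
    (hF : ∀ x : F, x ^ p = x) (s : Finset ι) (β : ι → F) {k : ℕ} (hk1 : 1 ≤ k)
    (hk : 2 * k ≤ p + 1) (hs : s.card + 1 = p + k)
    (hcoeff : ∀ j, k ≤ j → j < p → (∏ i ∈ s, (X - C (β i))).coeff j = 0) :
    ∃ c : F, (X - C c) ^ p ∣ ∏ i ∈ s, (X - C (β i)) := by
  classical
  have hp : 2 ≤ p := (Fact.out : p.Prime).two_le
  set f : F[X] := ∏ i ∈ s, (X - C (β i)) with hf
  have hfm : f.Monic := monic_prod_of_monic _ _ fun i _ => monic_X_sub_C _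
  have hfd : f.natDegree = s.card := by simp [hf, natDegree_finsetProd_X_sub_C_eq_card]
  set g : F[X] := f /ₘ X ^ p with hg
  set h : F[X] := f %ₘ X ^ p with hh
  have hfgh : f = X ^ p * g + h := by
    rw [add_comm]; exact (modByMonic_add_div f (X ^ p)).symm
  have hgd : g.natDegree = k - 1 := by
    rw [hg, natDegree_divByMonic _ (monic_X_pow p), hfd, natDegree_X_pow]; omega
  have hXf : degree (X ^ p : F[X]) ≤ f.degree := by
    rw [degree_X_pow, degree_eq_natDegree hfm.ne_zero, hfd]
    exact_mod_cast (by omega : p ≤ s.card)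
  have hgm : g.Monic := by
    have := leadingCoeff_divByMonic_of_monic (monic_X_pow p) hXf
    rw [Monic, hg, this]; exact hfm
  have hhp : h.degree < p := by
    simpa using degree_modByMonic_lt f (monic_X_pow (R := F) p)
  have hhd : h.natDegree ≤ k - 1 := by
    rw [natDegree_le_iff_coeff_eq_zero]
    intro j hj
    by_cases hjp : j < p
    · have := hcoeff j (by omega) hjp
      rw [hfgh, coeff_add, coeff_X_pow_mul', if_neg (by omega), zero_add] at this
      exact this
    · exact coeff_eq_zero_of_degree_lt (hhp.trans_le (by exact_mod_cast (by omega : p ≤ j)))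
  -- every root of `f` is a root of `X * g + h`
  have hA : ∀ i ∈ s, (X - C (β i)) ∣ X * g + h := by
    intro i hi
    have h0 : f.eval (β i) = 0 := by
      rw [hf, eval_prod]; exact Finset.prod_eq_zero hi (by simp)
    rw [hfgh] at h0
    simp only [eval_add, eval_mul, eval_pow, eval_X, hF] at h0
    rw [dvd_iff_isRoot]
    simpa using h0
  have hAf : f ∣ (X * g + h) * derivative f := by
    nth_rewrite 2 [hf]
    rw [derivative_prod_finset, Finset.mul_sum]
    refine Finset.dvd_sum fun i hi => ?_
    rw [derivative_X_sub_C, mul_one, hf, ← Finset.mul_prod_erase _ _ hi]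
    exact mul_dvd_mul (hA i hi) dvd_rfl
  have hder : derivative f = X ^ p * derivative g + derivative h := by
    rw [hfgh]; simp [derivative_X_pow]
  have hW : f ∣ (X * g + h) * (g * derivative h - derivative g * h) := by
    have e : (X * g + h) * (g * derivative h - derivative g * h) =
        g * ((X * g + h) * derivative f) - f * (derivative g * (X * g + h)) := by
      rw [hder]; linear_combination (derivative g * (X * g + h)) * hfgh
    rw [e]
    exact dvd_sub (hAf.mul_left _) (dvd_mul_right _ _)
  have hgd' := natDegree_derivative_le g
  have hhd' := natDegree_derivative_le h
  have hA0 : X * g + h ≠ 0 := by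
    intro h0
    have : (X * g + h).coeff k = 0 := by rw [h0]; simp
    obtain ⟨k, rfl⟩ : ∃ m, k = m + 1 := ⟨k - 1, by omega⟩
    rw [coeff_add, coeff_X_mul, coeff_eq_zero_of_natDegree_lt (p := h) (by omega), add_zero] at this
    rw [Monic, leadingCoeff, hgd, Nat.add_sub_cancel, this] at hgm
    exact zero_ne_one hgm
  have hW0 : g * derivative h - derivative g * h = 0 := by
    have : (X * g + h) * (g * derivative h - derivative g * h) = 0 := by
      refine eq_zero_of_dvd_of_natDegree_lt hW ?_
      rw [hfd]
      have h1 : (X * g + h).natDegree ≤ k := by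
        refine natDegree_add_le_of_degree_le (natDegree_mul_le.trans ?_) (by omega)
        rw [natDegree_X]; omega
      have h2 : (g * derivative h - derivative g * h).natDegree ≤ (k - 1) + (k - 1 - 1) := by
        refine (natDegree_sub_le _ _).trans
          (max_le (natDegree_mul_le.trans ?_) (natDegree_mul_le.trans ?_)) <;> omega
      have := natDegree_mul_le (p := X * g + h) (q := g * derivative h - derivative g * h)
      omega
    exact (mul_eq_zero.mp this).resolve_left hA0
  -- hence `h` is a constant multiple of `g`
  set c : F := h.coeff (k - 1) with hc
  have hr : h - C c * g = 0 := by
    by_contra hr0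
    set r := h - C c * g with hr
    have hrW : g * derivative r = derivative g * r := by
      rw [hr]; simp only [derivative_sub, derivative_C_mul]; linear_combination hW0
    have hrd : r.natDegree < k - 1 := by
      have hle : r.natDegree ≤ k - 1 :=
        (natDegree_sub_le _ _).trans (max_le hhd ((natDegree_C_mul_le _ _).trans hgd.le))
      refine lt_of_le_of_ne hle fun he => hr0 ?_
      rw [← leadingCoeff_eq_zero, leadingCoeff, he, hr, coeff_sub, coeff_C_mul, ← hgd,
        coeff_natDegree, hgm.leadingCoeff, hgd]
      simp [hc]
    have hX : g * (X * derivative r) = (X * derivative g) * r := by linear_combination X * hrW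
    have hXc : ∀ (u : F[X]) (j : ℕ), (X * derivative u).coeff j = u.coeff j * j := by
      intro u j
      cases j with
      | zero => simp
      | succ j => rw [coeff_X_mul, coeff_derivative]; push_cast; ring
    have hXd : ∀ u : F[X], (X * derivative u).natDegree ≤ u.natDegree := by
      intro u
      rw [natDegree_le_iff_coeff_eq_zero]
      intro j hj
      rw [hXc, coeff_eq_zero_of_natDegree_lt hj, zero_mul]
    have h3 : (g * (X * derivative r)).coeff (g.natDegree + r.natDegree) =
        (X * derivative g * r).coeff (g.natDegree + r.natDegree) := by rw [hX]
    rw [coeff_mul_add_eq_of_natDegree_le le_rfl (hXd r), coeff_mul_add_eq_of_natDegree_le (hXd g) le_rfl, hXc,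
      hXc, coeff_natDegree, hgm.leadingCoeff, hgd] at h3
    have h4 : ((k - 1 - r.natDegree : ℕ) : F) * r.leadingCoeff = 0 := by
      rw [Nat.cast_sub hrd.le]; rw [leadingCoeff]; linear_combination -h3
    rcases mul_eq_zero.mp h4 with h5 | h5
    · rw [CharP.cast_eq_zero_iff F p] at h5
      exact absurd (Nat.le_of_dvd (by omega) h5) (by omega)
    · exact hr0 (leadingCoeff_eq_zero.mp h5)
  refine ⟨-c, g, ?_⟩
  have e : (X - C (-c)) ^ p = X ^ p + C c := by
    rw [C_neg, sub_neg_eq_add, add_pow_char, ← C_pow, hF]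
  rw [e, hfgh]
  linear_combination hr

theorem totalDegree_prod_linear_le {F ι : Type*} [Field F] (s : Finset ι) (α β : ι → F) :
    (∏ i ∈ s, (MvPolynomial.X 0 - MvPolynomial.C (β i) * MvPolynomial.X 1 -
      MvPolynomial.C (α i)) : MvPolynomial (Fin 2) F).totalDegree ≤ s.card := by
  refine (MvPolynomial.totalDegree_finsetProd _ _).trans ?_
  rw [Finset.card_eq_sum_ones]
  refine Finset.sum_le_sum fun i _ => ?_
  refine (MvPolynomial.totalDegree_sub _ _).trans (max_le
    ((MvPolynomial.totalDegree_sub _ _).trans (max_le (by simp) ?_)) (by simp))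
  refine (MvPolynomial.totalDegree_mul _ _).trans (by simp)

theorem coeff_prod_linear {F ι : Type*} [Field F] (s : Finset ι) (α β : ι → F) (j m : ℕ)
    (h : j + m = s.card) :
    (∏ i ∈ s, (MvPolynomial.X 0 - MvPolynomial.C (β i) * MvPolynomial.X 1 -
      MvPolynomial.C (α i)) : MvPolynomial (Fin 2) F).coeff
        (Finsupp.single 0 j + Finsupp.single 1 m) =
      (∏ i ∈ s, (Polynomial.X - Polynomial.C (β i))).coeff j := by
  classical
  induction s using Finset.induction_on generalizing j m with
  | empty =>
    obtain ⟨rfl, rfl⟩ : j = 0 ∧ m = 0 := by simpa using h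
    simp
  | insert a s ha ih =>
    rw [Finset.card_insert_of_notMem ha] at h
    rw [Finset.prod_insert ha, Finset.prod_insert ha]
    have hdeg := totalDegree_prod_linear_le s α β
    set R := (∏ i ∈ s, (MvPolynomial.X 0 - MvPolynomial.C (β i) * MvPolynomial.X 1 -
      MvPolynomial.C (α i)) : MvPolynomial (Fin 2) F)
    have hfd : (∏ i ∈ s, (Polynomial.X - Polynomial.C (β i))).natDegree = s.card := by
      simp [Polynomial.natDegree_finsetProd_X_sub_C_eq_card]
    set f := ∏ i ∈ s, (Polynomial.X - Polynomial.C (β i))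
    have h0 : (MvPolynomial.X 0 * R).coeff (Finsupp.single 0 j + Finsupp.single 1 m) =
        (Polynomial.X * f).coeff j := by
      cases j with
      | zero => simp [MvPolynomial.coeff_X_mul']
      | succ j =>
        rw [Polynomial.coeff_X_mul, ← ih j m (by omega), add_comm j, Finsupp.single_add, add_assoc,
          MvPolynomial.coeff_X_mul]
    have h1 : (MvPolynomial.X 1 * R).coeff (Finsupp.single 0 j + Finsupp.single 1 m) =
        f.coeff j := by
      cases m with
      | zero =>
        rw [Polynomial.coeff_eq_zero_of_natDegree_lt (by omega)]
        simp [MvPolynomial.coeff_X_mul']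
      | succ m =>
        rw [← ih j m (by omega), add_comm m, Finsupp.single_add, add_left_comm,
          MvPolynomial.coeff_X_mul]
    have h2 : R.coeff (Finsupp.single 0 j + Finsupp.single 1 m) = 0 := by
      apply MvPolynomial.coeff_eq_zero_of_totalDegree_lt
      refine lt_of_le_of_lt hdeg ?_
      have := map_add Finsupp.degree (Finsupp.single (0 : Fin 2) j) (Finsupp.single 1 m)
      simp only [Finsupp.degree_single] at this
      change _ < Finsupp.degree _
      omega
    rw [sub_mul, sub_mul, mul_assoc, MvPolynomial.coeff_sub, MvPolynomial.coeff_sub,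
      MvPolynomial.coeff_C_mul, MvPolynomial.coeff_C_mul, h0, h1, h2, sub_mul,
      Polynomial.coeff_sub, Polynomial.coeff_C_mul, mul_zero, sub_zero]

/-- A finite set of vectors blocks the hyperplanes if every nonzero functional vanishes at one of
its members. -/
def BlocksHyperplanes (F : Type*) {V : Type*} [Field F] [AddCommGroup V] [Module F V]
    (B : Finset V) : Prop :=
  ∀ φ : Module.Dual F V, φ ≠ 0 → ∃ b ∈ B, φ b = 0

theorem coeff_eq_zero_of_forall_exists_eq {F ι : Type*} [Field F] [Fintype F]
    (s : Finset ι) (α β : ι → F) (hR : ∀ t u : F, ∃ i ∈ s, t - β i * u - α i = 0)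
    (j m : ℕ) (hjm : j + m = s.card) (hj : j < Fintype.card F) (hm : m < Fintype.card F) :
    (∏ i ∈ s, (Polynomial.X - Polynomial.C (β i))).coeff j = 0 := by
  classical
  by_contra hne
  rw [← coeff_prod_linear s α β j m hjm] at hne
  have hdeg : (Finsupp.single (0 : Fin 2) j + Finsupp.single 1 m).degree = s.card := by
    rw [map_add]; simpa using hjm
  obtain ⟨x, -, hx⟩ := MvPolynomial.combinatorial_nullstellensatz_exists_eval_nonzero _ _ hne
    (le_antisymm ((totalDegree_prod_linear_le s α β).trans hdeg.ge)
      (MvPolynomial.le_totalDegree (MvPolynomial.mem_support_iff.mpr hne)))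
    (fun _ => Finset.univ) (fun i => by fin_cases i <;> simpa)
  obtain ⟨i, hi, h0⟩ := hR (x 0) (x 1)
  apply hx
  rw [map_prod]
  exact Finset.prod_eq_zero hi (by simpa using h0)

open Polynomial in
theorem card_le_card_filter_of_pow_dvd_prod {F ι : Type*} [Field F] [DecidableEq F]
    (s : Finset ι) (β : ι → F) (c : F) (p : ℕ) (h : (X - C c) ^ p ∣ ∏ i ∈ s, (X - C (β i))) :
    p ≤ (s.filter fun i => β i = c).card := by
  have h0 : ∏ i ∈ s, (X - C (β i)) ≠ 0 :=
    (monic_prod_of_monic _ _ fun i _ => monic_X_sub_C _).ne_zero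
  have h1 := (le_rootMultiplicity_iff h0).mpr h
  rw [← count_roots, roots_prod _ _ h0] at h1
  simp only [roots_X_sub_C] at h1
  rw [Multiset.count_bind] at h1
  refine h1.trans (le_of_eq ?_)
  rw [Finset.card_filter]
  simp only [Multiset.count_singleton, eq_comm]
  rfl

theorem exists_card_lt_card_filter {F V : Type*} [Field F] [Fintype F] [AddCommGroup V]
    [Module F V] [FiniteDimensional F V] [DecidableEq V] [DecidableEq F]
    (hprime : (Fintype.card F).Prime) (hV : 3 ≤ Module.finrank F V)
    (B : Finset V) (hB : BlocksHyperplanes F B) (hcard : 2 * B.card ≤ 3 * Fintype.card F + 1)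
    (P : V) (hP : P ∈ B) (hP0 : P ≠ 0) (z : Module.Dual F V) (hzP : z P = 0)
    (hz : ∀ b ∈ B, b ≠ P → z b ≠ 0) :
    ∃ κ : Module.Dual F V, κ ≠ 0 ∧ Fintype.card F < (B.filter fun b => κ b = 0).card := by
  set p := Fintype.card F with hp
  have : Fact p.Prime := ⟨hprime⟩
  have : CharP F p := charP_of_card_eq_prime hp.symm
  obtain ⟨x, hx⟩ : ∃ x : Module.Dual F V, x P ≠ 0 := by
    by_contra! h
    exact hP0 ((Module.forall_dual_apply_eq_zero_iff F P).mp h)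
  -- a functional `y` that vanishes at `P` and is not a multiple of `z`
  obtain ⟨v, hvz, hvP⟩ : ∃ v : V, z v = 0 ∧ v ∉ Submodule.span F {P} := by
    by_contra! h
    have hle : LinearMap.ker z ≤ Submodule.span F {P} := fun v hv => h v hv
    have h1 := Submodule.finrank_mono hle
    have h2 := finrank_span_singleton (K := F) hP0
    have h3 := LinearMap.finrank_range_add_finrank_ker z
    have h4 := Submodule.finrank_le (LinearMap.range z)
    rw [Module.finrank_self] at h4
    omega
  obtain ⟨y, hyv, hyP⟩ := Submodule.exists_le_ker_of_notMem hvP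
  replace hyP : y P = 0 := hyP (Submodule.mem_span_singleton_self P)
  set s := B.erase P with hs
  have hsc : s.card + 1 = B.card := Finset.card_erase_add_one hP
  have hzs : ∀ b ∈ s, z b ≠ 0 := fun b hb =>
    hz b (Finset.mem_of_mem_erase hb) (Finset.ne_of_mem_erase hb)
  have hR : ∀ t u : F, ∃ b ∈ s, t - y b / z b * u - x b / z b = 0 := by
    intro t u
    have hφP : (t • z - u • y - x) P ≠ 0 := by simpa [hzP, hyP] using hx
    obtain ⟨b, hb, hb0⟩ := hB (t • z - u • y - x) (fun h => hφP (by rw [h]; rfl))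
    have hbs : b ∈ s := Finset.mem_erase.mpr ⟨fun h => hφP (h ▸ hb0), hb⟩
    refine ⟨b, hbs, ?_⟩
    have := hzs b hbs
    simp only [LinearMap.sub_apply, LinearMap.smul_apply, smul_eq_mul] at hb0
    field_simp
    linear_combination hb0
  have hps : p ≤ s.card := by
    by_contra! hlt
    have h0 := coeff_eq_zero_of_forall_exists_eq s _ _ hR s.card 0 rfl hlt hprime.pos
    have hm : (∏ i ∈ s, (Polynomial.X - Polynomial.C (y i / z i))).Monic :=
      Polynomial.monic_prod_of_monic _ _ fun i _ => Polynomial.monic_X_sub_C _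
    have hd : (∏ i ∈ s, (Polynomial.X - Polynomial.C (y i / z i))).natDegree = s.card := by
      simp [Polynomial.natDegree_finsetProd_X_sub_C_eq_card]
    rw [Polynomial.Monic, Polynomial.leadingCoeff, hd, h0] at hm
    exact zero_ne_one hm
  obtain ⟨k, hk⟩ : ∃ k, s.card + 1 = p + k := ⟨s.card + 1 - p, by omega⟩
  obtain ⟨c, hc⟩ := exists_pow_dvd_of_lacunary (p := p) (fun a => FiniteField.pow_card a) s
    (fun b => y b / z b) (k := k) (by omega) (by omega) hk (fun j hj hjp =>
      coeff_eq_zero_of_forall_exists_eq s _ _ hR j (s.card - j) (by omega) hjp (by omega))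
  refine ⟨y - c • z, fun h => hyv ?_, ?_⟩
  · simpa [hvz] using LinearMap.congr_fun h v
  · refine (card_le_card_filter_of_pow_dvd_prod s _ c p hc).trans_lt (Finset.card_lt_card ?_)
    rw [Finset.ssubset_iff]
    refine ⟨P, by simp [hs], ?_⟩
    intro b hb
    rcases Finset.mem_insert.mp hb with rfl | hb
    · simp [hP, hyP, hzP]
    · obtain ⟨hbs, hbc⟩ := Finset.mem_filter.mp hb
      have := hzs b hbs
      refine Finset.mem_filter.mpr ⟨Finset.mem_of_mem_erase hbs, ?_⟩
      rw [div_eq_iff this] at hbc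
      simp [hbc]

/-- A blocking set with respect to hyperplanes with at most `(3p + 1) / 2` points, `p` prime,
contains all points of some line. -/
theorem exists_line_of_blocksHyperplanes {F V : Type*} [Field F] [Fintype F] [AddCommGroup V]
    [Module F V] [FiniteDimensional F V] (hprime : (Fintype.card F).Prime)
    (hV : 2 ≤ Module.finrank F V) (B : Finset V) (h0 : (0 : V) ∉ B) (hB : BlocksHyperplanes F B)
    (hcard : 2 * B.card ≤ 3 * Fintype.card F + 1) :
    ∃ W : Submodule F V, Module.finrank F W = 2 ∧
      ∀ w ∈ W, w ≠ 0 → ∃ b ∈ B, w ∈ Submodule.span F {b} := by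
  classical
  obtain ⟨d, hd⟩ : ∃ d, Module.finrank F V = d := ⟨_, rfl⟩
  induction d using Nat.strong_induction_on generalizing V with
  | _ d ih =>
  rcases hV.eq_or_lt with h2 | h3
  · refine ⟨⊤, by rw [finrank_top, ← h2], fun w _ hw => ?_⟩
    obtain ⟨v, hv⟩ : ∃ v : V, v ∉ Submodule.span F {w} := by
      by_contra! h
      have h1 := finrank_span_singleton (K := F) hw
      rw [(Submodule.eq_top_iff').mpr h, finrank_top] at h1
      omega
    obtain ⟨φ, hφv, hφw⟩ := Submodule.exists_le_ker_of_notMem hv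
    obtain ⟨b, hb, hb0⟩ := hB φ (fun h => hφv (by simp [h]))
    have hb1 : b ≠ 0 := fun h => h0 (h ▸ hb)
    refine ⟨b, hb, ?_⟩
    have hker : LinearMap.ker φ = Submodule.span F {w} := by
      refine (Submodule.eq_of_le_of_finrank_le hφw ?_).symm
      have h1 := finrank_span_singleton (K := F) hw
      have h4 : LinearMap.range φ ≠ ⊥ := fun h => hφv (by simp [LinearMap.range_eq_bot.mp h])
      have h5 := Submodule.one_le_finrank_iff.mpr h4
      have h6 := LinearMap.finrank_range_add_finrank_ker φ
      omega
    have hbw : b ∈ Submodule.span F {w} := hker ▸ hb0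
    obtain ⟨a, rfl⟩ := Submodule.mem_span_singleton.mp hbw
    have ha : a ≠ 0 := fun h => hb1 (by simp [h])
    exact Submodule.mem_span_singleton.mpr ⟨a⁻¹, by simp [smul_smul, ha]⟩
  · obtain ⟨B', hB'B, hmin⟩ := exists_minimal_le_of_wellFoundedLT
      (fun A : Finset V => BlocksHyperplanes F A) B hB
    have hB' : BlocksHyperplanes F B' := hmin.prop
    have hcard' : B'.card ≤ B.card := Finset.card_le_card hB'B
    have hne : ∃ φ : Module.Dual F V, φ ≠ 0 := by
      have : Nontrivial V := Module.nontrivial_of_finrank_pos (R := F) (by omega)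
      exact exists_ne 0
    obtain ⟨φ₀, hφ₀⟩ := hne
    obtain ⟨P, hP, -⟩ := hB' φ₀ hφ₀
    have hP0 : P ≠ 0 := fun h => h0 (hB'B (h ▸ hP))
    obtain ⟨z, hz0, hz⟩ : ∃ z : Module.Dual F V, z ≠ 0 ∧ ∀ b ∈ B'.erase P, z b ≠ 0 := by
      by_contra! h
      exact Finset.notMem_erase P B' (hmin.le_of_le h (Finset.erase_subset P B') hP)
    have hzP : z P = 0 := by
      obtain ⟨b, hb, hb0⟩ := hB' z hz0
      by_contra hzP
      exact hz b (Finset.mem_erase.mpr ⟨fun h => hzP (h ▸ hb0), hb⟩) hb0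
    obtain ⟨κ, hκ, hκc⟩ := exists_card_lt_card_filter hprime h3 B' hB' (by omega) P hP hP0 z hzP
      (fun b hb hbP => hz b (Finset.mem_erase.mpr ⟨hbP, hb⟩))
    let K := LinearMap.ker κ
    have hKd : Module.finrank F K + 1 = Module.finrank F V := by
      have h6 : _ + Module.finrank F K = _ := LinearMap.finrank_range_add_finrank_ker κ
      rw [LinearMap.range_eq_top.mpr (LinearMap.surjective_of_ne_zero hκ), finrank_top,
        Module.finrank_self] at h6
      omega
    have hsplit := Finset.card_filter_add_card_filter_not (s := B') (fun b => κ b = 0)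
    let BK : Finset K := B'.preimage K.subtype Subtype.val_injective.injOn
    have hBKc : BK.card ≤ B'.card :=
      Finset.card_le_card_of_injOn Subtype.val (fun b hb => by simpa [BK] using hb)
        Subtype.val_injective.injOn
    have hBK : BlocksHyperplanes F BK := by
      intro φ hφ
      obtain ⟨ψ, hψ⟩ := LinearMap.exists_extend φ
      by_contra! hno
      have hex : ∀ t : F, ∃ b ∈ B', (ψ + t • κ) b = 0 := fun t => hB' _ (by
        intro h
        apply hφ
        ext w
        have h7 := LinearMap.congr_fun h (w : V)
        have h8 : κ w = 0 := w.2
        rw [← hψ]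
        simpa [h8] using h7)
      choose b hb hb0 using hex
      have hbκ : ∀ t, κ (b t) ≠ 0 := by
        intro t ht
        refine hno ⟨b t, ht⟩ (by simpa [BK] using hb t) ?_
        rw [← hψ]
        simpa [ht] using hb0 t
      have hinj : Function.Injective b := by
        intro t t' htt
        have h9 := hb0 t
        have h10 := hb0 t'
        rw [← htt] at h10
        simp only [LinearMap.add_apply, LinearMap.smul_apply, smul_eq_mul] at h9 h10
        exact mul_right_cancel₀ (hbκ t) (by linear_combination h9 - h10)
      have hle : Fintype.card F ≤ (B'.filter fun b => ¬ κ b = 0).card := by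
        rw [← Finset.card_univ]
        exact Finset.card_le_card_of_injOn b
          (fun t _ => by simpa using ⟨hb t, hbκ t⟩) hinj.injOn
      have := hprime.two_le
      omega
    obtain ⟨W, hW2, hW⟩ := ih (Module.finrank F K) (by omega) (V := K) (by omega) BK
      (fun h => h0 (hB'B (by simpa [BK] using h))) hBK (by omega) rfl
    refine ⟨W.map K.subtype, ?_, ?_⟩
    · rw [Submodule.finrank_map_subtype_eq, hW2]
    · rintro _ ⟨w, hw, rfl⟩ hw0
      obtain ⟨b, hb, hbw⟩ := hW w hw (fun h => hw0 (by simp [h]))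
      refine ⟨b, hB'B (by simpa [BK] using hb), ?_⟩
      obtain ⟨a, rfl⟩ := Submodule.mem_span_singleton.mp hbw
      exact Submodule.mem_span_singleton.mpr ⟨a, by simp⟩

theorem card_filter_mem_submodule_ne_zero {F V : Type*} [Field F] [Fintype F] [AddCommGroup V]
    [Module F V] [Fintype V] [DecidableEq V] (W : Submodule F V) [DecidablePred (· ∈ W)] :
    (Finset.univ.filter fun v : V => v ∈ W ∧ v ≠ 0).card + 1 =
      Fintype.card F ^ Module.finrank F W := by
  have h1 : (Finset.univ.filter fun v : V => v ∈ W ∧ v ≠ 0) =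
      (Finset.univ.filter fun v : V => v ∈ W).erase 0 := by
    ext v; simp [and_comm]
  rw [h1, Finset.card_erase_add_one (by simp), ← Module.card_eq_pow_finrank (K := F) (V := W),
    Fintype.card_subtype]

/-- Counting along the pencil of hyperplanes spanned by two functionals. -/
theorem card_filter_add_sum_card_filter_pencil {F V : Type*} [Field F] [Fintype F]
    [DecidableEq F] [AddCommGroup V] [Module F V] (X : Finset V) (φ ψ : Module.Dual F V) :
    (X.filter fun v => φ v = 0).card + ∑ t : F, (X.filter fun v => (ψ + t • φ) v = 0).card =
      X.card + Fintype.card F * (X.filter fun v => φ v = 0 ∧ ψ v = 0).card := by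
  simp only [Finset.card_filter, Finset.card_eq_sum_ones X]
  rw [Finset.sum_comm, ← Finset.sum_add_distrib, Finset.mul_sum, ← Finset.sum_add_distrib]
  refine Finset.sum_congr rfl fun v _ => ?_
  simp only [LinearMap.add_apply, LinearMap.smul_apply, smul_eq_mul]
  by_cases hφ : φ v = 0
  · by_cases hψ : ψ v = 0 <;> simp [hφ, hψ]
  · have : ∀ t : F, (ψ v + t * φ v = 0) ↔ t = -ψ v / φ v := by
      intro t
      rw [eq_div_iff hφ, eq_neg_iff_add_eq_zero, add_comm]
    simp [hφ, this]

/-- A set of vectors closed under scaling has a system of representatives up to scalars. -/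
theorem exists_representatives {F V : Type*} [Field F] [Fintype F] [AddCommGroup V] [Module F V]
    (X : Finset V) (h0 : (0 : V) ∉ X) (hX : ∀ v ∈ X, ∀ a : F, a ≠ 0 → a • v ∈ X) :
    ∃ B ⊆ X, (Fintype.card F - 1) * B.card ≤ X.card ∧ ∀ v ∈ X, ∃ b ∈ B, ∃ a : F, a ≠ 0 ∧
      b = a • v := by
  classical
  let rep : V → V := fun v => if h : v = 0 then 0 else (Projectivization.mk F v h).rep
  have hrep : ∀ v ∈ X, ∃ a : F, a ≠ 0 ∧ rep v = a • v := by
    intro v hv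
    have hv0 : v ≠ 0 := fun h => h0 (h ▸ hv)
    obtain ⟨a, ha⟩ := Projectivization.exists_smul_eq_mk_rep F v hv0
    exact ⟨a, a.ne_zero, by simp only [rep, dif_neg hv0, ← ha]; rfl⟩
  have hrepX : ∀ v ∈ X, rep v ∈ X := by
    intro v hv
    obtain ⟨a, ha, h⟩ := hrep v hv
    exact h ▸ hX v hv a ha
  refine ⟨X.image rep, Finset.image_subset_iff.mpr hrepX, ?_, fun v hv =>
    ⟨rep v, Finset.mem_image_of_mem _ hv, hrep v hv⟩⟩
  refine Finset.mul_card_image_le_card X _ fun b hb => ?_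
  obtain ⟨v, hv, rfl⟩ := Finset.mem_image.mp hb
  have hv0 : v ≠ 0 := fun h => h0 (h ▸ hv)
  have hc : (Finset.univ.erase (0 : F)).card = Fintype.card F - 1 := by
    rw [Finset.card_erase_of_mem (Finset.mem_univ _), Finset.card_univ]
  rw [← hc]
  refine Finset.card_le_card_of_injOn (fun a => a • v) (fun a ha => ?_)
    ((smul_left_injective F hv0).injOn)
  have ha0 : a ≠ 0 := by simpa using ha
  have hav : a • v ≠ 0 := smul_ne_zero ha0 hv0
  simp only [Finset.coe_filter, Set.mem_ofPred_eq]
  refine ⟨hX v hv a ha0, ?_⟩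
  simp only [rep, dif_neg hav, dif_neg hv0]
  congr 1
  rw [Projectivization.mk_eq_mk_iff']
  exact ⟨a, rfl⟩

/-- A small set of vectors closed under scaling has tangent subspaces of every codimension at
least two. -/
theorem exists_tangent_submodule {F V : Type*} [Field F] [Fintype F] [AddCommGroup V]
    [Module F V] [Fintype V] (X : Finset V)
    (hX : ∀ v ∈ X, ∀ a : F, a ≠ 0 → a • v ∈ X) (hcard : X.card + 1 < Fintype.card F ^ 3)
    (P : V) (hP0 : P ≠ 0) (j : ℕ) (hj : j + 3 ≤ Module.finrank F V) :
    ∃ U : Submodule F V, Module.finrank F U = j + 1 ∧ P ∈ U ∧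
      ∀ v ∈ X, v ∈ U → v ∈ Submodule.span F {P} := by
  classical
  induction j with
  | zero =>
    exact ⟨Submodule.span F {P}, finrank_span_singleton hP0, Submodule.mem_span_singleton_self P,
      fun _ _ h => h⟩
  | succ j ih =>
    obtain ⟨T, hTd, hPT, hTX⟩ := ih (by omega)
    let T' : Finset V := Finset.univ.filter (· ∈ T)
    have hT' : T'.card = Fintype.card F ^ (j + 1) := by
      rw [← hTd, ← Module.card_eq_pow_finrank (K := F) (V := T), Fintype.card_subtype]
    have hq := Fintype.card_pos (α := F)
    obtain ⟨v, hv⟩ : ∃ v : V, v ∉ T' ∪ (X ×ˢ T').image fun w => w.1 + w.2 := by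
      by_contra! h
      have h1 := Finset.card_le_card (fun v _ => h v : (Finset.univ : Finset V) ⊆ _)
      have h2 := Finset.card_union_le T' ((X ×ˢ T').image fun w => w.1 + w.2)
      have h3 := Finset.card_image_le (s := X ×ˢ T') (f := fun w => w.1 + w.2)
      rw [Finset.card_product, hT'] at h3
      rw [Finset.card_univ, Module.card_eq_pow_finrank (K := F) (V := V)] at h1
      have h4 : Fintype.card F ^ (j + 1 + 3) ≤ Fintype.card F ^ Module.finrank F V :=
        Nat.pow_le_pow_right hq (by omega)
      rw [pow_add] at h4
      have h5 : Fintype.card F ^ (j + 1) * (X.card + 1) <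
          Fintype.card F ^ (j + 1) * Fintype.card F ^ 3 :=
        Nat.mul_lt_mul_of_pos_left hcard (by positivity)
      rw [hT'] at h2
      linarith
    rw [Finset.mem_union, not_or] at hv
    obtain ⟨hvT, hvX⟩ := hv
    replace hvT : v ∉ T := by simpa [T'] using hvT
    refine ⟨T ⊔ Submodule.span F {v}, ?_, Submodule.mem_sup_left hPT, ?_⟩
    · have h1 := Submodule.finrank_sup_add_finrank_inf_eq T (Submodule.span F {v})
      have hv0 : v ≠ 0 := fun h => hvT (h ▸ T.zero_mem)
      have h2 : T ⊓ Submodule.span F {v} = ⊥ :=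
        disjoint_iff.mp ((Submodule.disjoint_span_singleton' hv0).mpr hvT)
      rw [h2, finrank_bot, finrank_span_singleton hv0] at h1
      omega
    · intro x hx hxU
      obtain ⟨t, ht, w, hw, rfl⟩ := Submodule.mem_sup.mp hxU
      obtain ⟨a, rfl⟩ := Submodule.mem_span_singleton.mp hw
      by_cases ha : a = 0
      · subst ha
        exact hTX _ hx (by simpa using ht)
      · exfalso
        apply hvX
        refine Finset.mem_image.mpr ⟨(a⁻¹ • (t + a • v), -(a⁻¹ • t)), ?_, ?_⟩
        · refine Finset.mem_product.mpr ⟨hX _ hx _ (inv_ne_zero ha), ?_⟩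
          simpa [T'] using T.neg_mem (T.smul_mem a⁻¹ ht)
        · simp [smul_smul, ha]

/-- A submodule of codimension two is the common kernel of two independent functionals. -/
theorem exists_dual_pair_of_finrank_add_two {F V : Type*} [Field F] [AddCommGroup V] [Module F V]
    [FiniteDimensional F V] (U : Submodule F V)
    (hU : Module.finrank F U + 2 = Module.finrank F V) :
    ∃ φ ψ : Module.Dual F V, (∀ v, φ v = 0 ∧ ψ v = 0 ↔ v ∈ U) ∧ φ ≠ 0 ∧
      ∀ t : F, ψ + t • φ ≠ 0 := by
  have hQ : Module.finrank F (V ⧸ U) = Module.finrank F (Fin 2 → F) := by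
    have := U.finrank_quotient_add_finrank
    rw [Module.finrank_fin_fun]; omega
  let e : (V ⧸ U) ≃ₗ[F] (Fin 2 → F) := LinearEquiv.ofFinrankEq _ _ hQ
  let π : V →ₗ[F] (Fin 2 → F) := e.toLinearMap ∘ₗ U.mkQ
  have hπ : Function.Surjective π := e.surjective.comp U.mkQ_surjective
  refine ⟨LinearMap.proj 0 ∘ₗ π, LinearMap.proj 1 ∘ₗ π, fun v => ?_, fun h => ?_, fun t h => ?_⟩
  · have : π v = 0 ↔ v ∈ U := by simp [π]
    rw [← this, funext_iff, Fin.forall_fin_two]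
    rfl
  · obtain ⟨v, hv⟩ := hπ ![1, 0]
    simpa [hv] using LinearMap.congr_fun h v
  · obtain ⟨v, hv⟩ := hπ ![0, 1]
    simpa [hv] using LinearMap.congr_fun h v

/-- A nonempty set of vectors closed under scaling, with `δ (q + 1)` points, such that every
hyperplane has at least `δ`, and modulo `q` exactly `δ`, of its points, contains a line if
`q` is prime and `δ ≤ (q + 1) / 2`. -/
theorem exists_line_of_card_hyperplane_sections {F V : Type*} [Field F] [Fintype F]
    [DecidableEq F] [AddCommGroup V] [Module F V] [Fintype V]
    (hprime : (Fintype.card F).Prime) (hV : 3 ≤ Module.finrank F V)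
    (X : Finset V) (h0 : (0 : V) ∉ X)
    (hX : ∀ v ∈ X, ∀ a : F, a ≠ 0 → a • v ∈ X) (δ : ℕ) (hδ : 0 < δ)
    (hδq : 2 * δ ≤ Fintype.card F + 1)
    (hcard : X.card = (Fintype.card F - 1) * (δ * (Fintype.card F + 1)))
    (hsec : ∀ φ : Module.Dual F V, φ ≠ 0 → ∃ r : ℕ, (X.filter fun v => φ v = 0).card =
      (Fintype.card F - 1) * (δ + Fintype.card F * r)) :
    ∃ W : Submodule F V, Module.finrank F W = 2 ∧ ∀ w ∈ W, w ≠ 0 → w ∈ X := by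
  classical
  obtain ⟨d, hd⟩ : ∃ d, Fintype.card F = d + 1 := ⟨Fintype.card F - 1, by
    have := hprime.pos; omega⟩
  have hd1 : 1 ≤ d := by have := hprime.two_le; omega
  choose! r hr using hsec
  -- the section by a subspace of codimension two is determined by `r` on its pencil
  have hpencil : ∀ φ ψ : Module.Dual F V, φ ≠ 0 → (∀ t : F, ψ + t • φ ≠ 0) →
      (X.filter fun v => φ v = 0 ∧ ψ v = 0).card = d * (r φ + ∑ t : F, r (ψ + t • φ)) := by
    intro φ ψ hφ hψ
    have h1 := card_filter_add_sum_card_filter_pencil X φ ψ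
    rw [hr φ hφ, Finset.sum_congr rfl fun t _ => hr (ψ + t • φ) (hψ t), hcard, ← Finset.mul_sum,
      Finset.sum_add_distrib, ← Finset.mul_sum, Finset.sum_const, Finset.card_univ, hd,
      Nat.add_sub_cancel, smul_eq_mul] at h1
    refine Nat.eq_of_mul_eq_mul_left (Nat.succ_pos d) ?_
    rw [Nat.succ_eq_add_one]
    linarith
  obtain ⟨P, hP⟩ : X.Nonempty := by
    rw [← Finset.card_pos, hcard, hd, Nat.add_sub_cancel]; positivity
  have hP0 : P ≠ 0 := fun h => h0 (h ▸ hP)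
  -- a hyperplane `χ` with `q + δ` points
  obtain ⟨χ, hχ, hχr⟩ : ∃ χ : Module.Dual F V, χ ≠ 0 ∧ r χ = 1 := by
    have hδd : δ ≤ d := by omega
    obtain ⟨U, hUd, hPU, hUX⟩ := exists_tangent_submodule X hX (by
      rw [hcard, hd, Nat.add_sub_cancel]
      nlinarith [Nat.mul_le_mul_left (d * (d + 2)) hδd]) P hP0
      (Module.finrank F V - 3) (by omega)
    obtain ⟨φ, ψ, hφψ, hφ, hψ⟩ := exists_dual_pair_of_finrank_add_two U (by omega)
    have h1 := hpencil φ ψ hφ hψ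
    have h2 : (X.filter fun v => φ v = 0 ∧ ψ v = 0) =
        Finset.univ.filter fun v => v ∈ Submodule.span F {P} ∧ v ≠ 0 := by
      ext v
      simp only [Finset.mem_filter, hφψ, Finset.mem_univ, true_and]
      refine ⟨fun h => ⟨hUX v h.1 h.2, fun h' => h0 (h' ▸ h.1)⟩, fun ⟨h, hv⟩ => ?_⟩
      obtain ⟨a, rfl⟩ := Submodule.mem_span_singleton.mp h
      exact ⟨hX P hP a fun ha => hv (by simp [ha]), U.smul_mem a hPU⟩
    have h3 := card_filter_mem_submodule_ne_zero (F := F) (Submodule.span F {P})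
    rw [finrank_span_singleton hP0, ← h2, h1, pow_one, hd] at h3
    have h4 : r φ + ∑ t : F, r (ψ + t • φ) = 1 :=
      Nat.eq_of_mul_eq_mul_left hd1 (by omega)
    by_cases hrφ : r φ = 0
    · rw [hrφ, zero_add] at h4
      obtain ⟨t, -, ht⟩ := Finset.exists_ne_zero_of_sum_ne_zero (by rw [h4]; exact one_ne_zero)
      have := Finset.single_le_sum (f := fun t => r (ψ + t • φ)) (fun _ _ => Nat.zero_le _)
        (Finset.mem_univ t)
      exact ⟨_, hψ t, by omega⟩
    · exact ⟨φ, hφ, by omega⟩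
  let H := LinearMap.ker χ
  have hHd : Module.finrank F H + 1 = Module.finrank F V := by
    have h6 : _ + Module.finrank F H = _ := LinearMap.finrank_range_add_finrank_ker χ
    rw [LinearMap.range_eq_top.mpr (LinearMap.surjective_of_ne_zero hχ), finrank_top,
      Module.finrank_self] at h6
    omega
  obtain ⟨B, hBX, hBc, hB⟩ := exists_representatives (F := F) (X.filter fun v => χ v = 0)
    (by simp [h0]) (fun v hv a ha => by
      obtain ⟨hv, hχv⟩ := Finset.mem_filter.mp hv
      exact Finset.mem_filter.mpr ⟨hX v hv a ha, by simp [hχv]⟩)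
  let BH : Finset H := B.preimage H.subtype Subtype.val_injective.injOn
  have hBHc : BH.card ≤ B.card :=
    Finset.card_le_card_of_injOn Subtype.val (fun b hb => by simpa [BH] using hb)
      Subtype.val_injective.injOn
  have hBc' : B.card ≤ δ + Fintype.card F := by
    rw [hr χ hχ, hχr, mul_one] at hBc
    exact Nat.le_of_mul_le_mul_left hBc (by omega)
  have hBX' : ∀ b : H, b ∈ BH → (b : V) ∈ X := fun b hb =>
    (Finset.mem_filter.mp (hBX (by simpa [BH] using hb))).1
  have hblock : BlocksHyperplanes F BH := by
    intro φ hφ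
    obtain ⟨ψ, hψ⟩ := LinearMap.exists_extend φ
    have hψχ : ∀ t : F, ψ + t • χ ≠ 0 := by
      intro t h
      apply hφ
      ext w
      have h7 := LinearMap.congr_fun h (w : V)
      have h8 : χ w = 0 := w.2
      rw [← hψ]
      simpa [h8] using h7
    have h1 := hpencil χ ψ hχ hψχ
    obtain ⟨v, hv⟩ : (X.filter fun v => χ v = 0 ∧ ψ v = 0).Nonempty := by
      rw [← Finset.card_pos, h1, hχr]; positivity
    obtain ⟨hvX, hvχ, hvψ⟩ := Finset.mem_filter.mp hv
    obtain ⟨b, hb, a, -, rfl⟩ := hB v (Finset.mem_filter.mpr ⟨hvX, hvχ⟩)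
    refine ⟨a • ⟨v, hvχ⟩, by simpa [BH] using hb, ?_⟩
    rw [← hψ]
    simp [hvψ]
  obtain ⟨W, hW2, hW⟩ := exists_line_of_blocksHyperplanes hprime (by omega) BH
    (fun h => h0 (hBX' _ h)) hblock (by omega)
  refine ⟨W.map H.subtype, by rw [Submodule.finrank_map_subtype_eq, hW2], ?_⟩
  rintro _ ⟨w, hw, rfl⟩ hw0
  obtain ⟨b, hb, hbw⟩ := hW w hw (fun h => hw0 (by simp [h]))
  obtain ⟨a, rfl⟩ := Submodule.mem_span_singleton.mp hbw
  exact hX b (hBX' b hb) a fun ha => hw0 (by simp [ha])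

open Classical in
/-- The nonzero vectors not covered by a set of subspaces. -/
noncomputable def holes {F V : Type*} [Field F] [AddCommGroup V] [Module F V] [Fintype V]
    (S : Set (Submodule F V)) : Finset V :=
  Finset.univ.filter fun v => v ≠ 0 ∧ ∀ l ∈ S, v ∉ l

theorem mem_holes {F V : Type*} [Field F] [AddCommGroup V] [Module F V] [Fintype V]
    {S : Set (Submodule F V)} {v : V} : v ∈ holes S ↔ v ≠ 0 ∧ ∀ l ∈ S, v ∉ l := by
  simp [holes]

open Classical in
theorem card_filter_holes_add_sum {F V : Type*} [Field F] [Fintype F] [AddCommGroup V]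
    [Module F V] [Fintype V] (S : Finset (Submodule F V))
    (hS : ∀ l ∈ S, ∀ l' ∈ S, l ≠ l' → l ⊓ l' = ⊥) (M : Submodule F V) :
    (((holes (S : Set (Submodule F V))).filter (· ∈ M)).card : ℤ) +
      ∑ l ∈ S, ((Fintype.card F : ℤ) ^ Module.finrank F ↥(l ⊓ M) - 1) =
      (Fintype.card F : ℤ) ^ Module.finrank F M - 1 := by
  have hnz : ∀ W : Submodule F V, ((Finset.univ.filter fun v : V => v ∈ W ∧ v ≠ 0).card : ℤ) =
      (Fintype.card F : ℤ) ^ Module.finrank F W - 1 := by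
    intro W
    have := card_filter_mem_submodule_ne_zero (F := F) W
    rw [eq_sub_iff_add_eq]
    exact_mod_cast this
  rw [← hnz M, Finset.sum_congr rfl fun l _ => (hnz (l ⊓ M)).symm, ← Nat.cast_sum,
    ← Finset.card_biUnion, ← Nat.cast_add, ← Finset.card_union_of_disjoint]
  · congr 2
    ext v
    simp only [Finset.mem_union, Finset.mem_filter, mem_holes, Finset.mem_biUnion,
      Finset.mem_univ, true_and, Submodule.mem_inf, Finset.mem_coe]
    by_cases h : ∃ l ∈ S, v ∈ l
    · obtain ⟨l, hl, hvl⟩ := h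
      exact ⟨by tauto, fun hv => Or.inr ⟨l, hl, ⟨hvl, hv.1⟩, hv.2⟩⟩
    · push Not at h
      exact ⟨by tauto, fun hv => Or.inl ⟨⟨hv.2, h⟩, hv.1⟩⟩
  · rw [Finset.disjoint_left]
    intro v hv hv'
    obtain ⟨l, hl, hvl⟩ := Finset.mem_biUnion.mp hv'
    simp only [Finset.mem_filter, Finset.mem_univ, true_and, Submodule.mem_inf] at hvl
    exact (mem_holes.mp (Finset.mem_filter.mp hv).1).2 l hl hvl.1.1
  · intro l hl l' hl' hll'
    rw [Function.onFun, Finset.disjoint_left]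
    intro v hv hv'
    simp only [Finset.mem_filter, Finset.mem_univ, true_and, Submodule.mem_inf] at hv hv'
    have : v ∈ l ⊓ l' := ⟨hv.1.1, hv'.1.1⟩
    rw [hS l hl l' hl' hll'] at this
    exact hv.2 this

theorem finrank_inf_ker_eq_one_or_two {F V : Type*} [Field F] [AddCommGroup V] [Module F V]
    [FiniteDimensional F V] (l : Submodule F V) (hl : Module.finrank F l = 2)
    (φ : Module.Dual F V) :
    Module.finrank F ↥(l ⊓ LinearMap.ker φ) = 1 ∨ Module.finrank F ↥(l ⊓ LinearMap.ker φ) = 2 := by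
  have h1 := Submodule.finrank_sup_add_finrank_inf_eq l (LinearMap.ker φ)
  have h2 := LinearMap.finrank_range_add_finrank_ker φ
  have h3 := Submodule.finrank_le (LinearMap.range φ)
  have h4 := Submodule.finrank_le (l ⊔ LinearMap.ker φ)
  have h5 := Submodule.finrank_mono (inf_le_left : l ⊓ LinearMap.ker φ ≤ l)
  rw [Module.finrank_self] at h3
  omega

/-- Every hyperplane section of the holes of a partial line spread of deficiency `δ < q` has at
least `δ`, and modulo `q` exactly `δ`, points. -/
theorem exists_card_filter_holes_eq {F V : Type*} [Field F] [Fintype F] [DecidableEq F]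
    [AddCommGroup V] [Module F V] [Fintype V] (S : Finset (Submodule F V))
    (hS2 : ∀ l ∈ S, Module.finrank F l = 2)
    (hS : ∀ l ∈ S, ∀ l' ∈ S, l ≠ l' → l ⊓ l' = ⊥) (m δ : ℕ)
    (hV : Module.finrank F V = 2 * m + 2) (hδ : δ < Fintype.card F)
    (hdef : (S.card + δ) * (Fintype.card F ^ 2 - 1) = Fintype.card F ^ (2 * m + 2) - 1)
    (φ : Module.Dual F V) (hφ : φ ≠ 0) :
    ∃ r : ℕ, ((holes (S : Set (Submodule F V))).filter fun v => φ v = 0).card =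
      (Fintype.card F - 1) * (δ + Fintype.card F * r) := by
  classical
  have hq : 1 < Fintype.card F := Fintype.one_lt_card
  have h1 := card_filter_holes_add_sum S hS (LinearMap.ker φ)
  have hfr : Module.finrank F (LinearMap.ker φ) = 2 * m + 1 := by
    have h6 := LinearMap.finrank_range_add_finrank_ker φ
    rw [LinearMap.range_eq_top.mpr (LinearMap.surjective_of_ne_zero hφ), finrank_top,
      Module.finrank_self] at h6
    omega
  simp only [LinearMap.mem_ker] at h1
  set x := (S.filter fun l => Module.finrank F ↥(l ⊓ LinearMap.ker φ) = 2).card with hx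
  set c := ((holes (S : Set (Submodule F V))).filter fun v => φ v = 0).card
  set q := Fintype.card F
  have hsum : ∑ l ∈ S, ((q : ℤ) ^ Module.finrank F ↥(l ⊓ LinearMap.ker φ) - 1) =
      S.card * (q - 1) + x * (q * (q - 1)) := by
    rw [hx, Finset.card_filter, Nat.cast_sum, Finset.sum_mul, Finset.card_eq_sum_ones,
      Nat.cast_sum, Finset.sum_mul, ← Finset.sum_add_distrib]
    refine Finset.sum_congr rfl fun l hl => ?_
    rcases finrank_inf_ker_eq_one_or_two l (hS2 l hl) φ with h | h
    · simp [h]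
    · simp [h]; ring
  rw [hsum, hfr] at h1
  obtain ⟨C, hC⟩ : q ^ 2 - 1 ∣ (q ^ 2) ^ m - 1 := by simpa using Nat.sub_dvd_pow_sub_pow (q ^ 2) 1 m
  have hq2 : 1 ≤ q ^ 2 := Nat.one_le_pow _ _ (by omega)
  have hqm : 1 ≤ (q ^ 2) ^ m := Nat.one_le_pow _ _ (by omega)
  have hqm2 : 1 ≤ q ^ (2 * m + 2) := Nat.one_le_pow _ _ (by omega)
  zify [hq2, hqm, hqm2] at hC hdef
  have hqZ : (1 : ℤ) < q := by exact_mod_cast hq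
  have e1 : (q : ℤ) ^ (2 * m + 2) = q ^ 2 * (q ^ 2) ^ m := by rw [pow_add, pow_mul]; ring
  have e2 : (q : ℤ) ^ (2 * m + 1) = q * (q ^ 2) ^ m := by rw [pow_add, pow_mul]; ring
  rw [e1] at hdef
  rw [e2] at h1
  have hScard : (S.card : ℤ) + δ = 1 + q ^ 2 * C := by
    have hne : (q : ℤ) ^ 2 - 1 ≠ 0 := by nlinarith
    exact mul_right_cancel₀ hne (by linear_combination hdef + q ^ 2 * hC)
  have hc : (c : ℤ) = (q - 1) * (δ + q * ((C : ℤ) - x)) := by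
    linear_combination h1 + q * hC - (q - 1 : ℤ) * hScard
  have hr : 0 ≤ (C : ℤ) - x := by
    by_contra! hlt
    have hc0 : (0 : ℤ) ≤ c := Int.natCast_nonneg c
    have hδ' : (δ : ℤ) < q := by exact_mod_cast hδ
    have : (δ : ℤ) + q * ((C : ℤ) - x) < 0 := by nlinarith
    have := mul_neg_of_pos_of_neg (sub_pos.mpr hqZ) this
    omega
  obtain ⟨r, hr⟩ := Int.eq_ofNat_of_zero_le hr
  refine ⟨r, ?_⟩
  rw [hr] at hc
  zify [hq.le]
  exact hc

/-- (Blokhuis) Let q be an odd prime and N ≥ 3 odd. A maximal partial line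
spread of PG(N,q) of deficiency δ > 0 satisfies δ ≥ (q+3)/2. -/
theorem stmt17 (F : Type*) [Field F] [Fintype F] (q : ℕ) (hq : Fintype.card F = q)
    (hprime : q.Prime) (hodd : Odd q) (N : ℕ) (hN3 : 3 ≤ N) (hNodd : Odd N)
    (S : Set (Submodule F (Fin (N + 1) → F)))
    (hS : IsMaximalPartialLineSpread F (N + 1) S)
    (δ : ℕ) (hδpos : 0 < δ)
    (hdef : S.ncard + δ = (q ^ (N + 1) - 1) / (q ^ 2 - 1)) :
    ((q : ℝ) + 3) / 2 ≤ (δ : ℝ) := by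
  classical
  obtain ⟨⟨hS2, hSd⟩, hmax⟩ := hS
  by_contra! hlt
  have hlt' : 2 * δ < q + 3 := by
    rw [lt_div_iff₀ two_pos] at hlt
    have : ((2 * δ : ℕ) : ℝ) < ((q + 3 : ℕ) : ℝ) := by push_cast; linarith
    exact_mod_cast this
  obtain ⟨m, rfl⟩ := hNodd
  subst hq
  have hq2 := hprime.two_le
  have hδ : 2 * δ ≤ Fintype.card F + 1 := by
    obtain ⟨a, ha⟩ := hodd
    omega
  have hV : Module.finrank F (Fin (2 * m + 1 + 1) → F) = 2 * m + 2 := by simp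
  obtain ⟨T, rfl⟩ : ∃ T : Finset (Submodule F (Fin (2 * m + 1 + 1) → F)), S = T :=
    ⟨S.toFinite.toFinset, by simp⟩
  rw [Set.ncard_coe_finset] at hdef
  have hdvd : Fintype.card F ^ 2 - 1 ∣ Fintype.card F ^ (2 * m + 2) - 1 := by
    have := Nat.sub_dvd_pow_sub_pow (Fintype.card F ^ 2) 1 (m + 1)
    rwa [one_pow, ← pow_mul] at this
  have hdef' : (T.card + δ) * (Fintype.card F ^ 2 - 1) = Fintype.card F ^ (2 * m + 2) - 1 := by
    rw [hdef]; exact Nat.div_mul_cancel hdvd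
  have hcard : (holes (T : Set (Submodule F (Fin (2 * m + 1 + 1) → F)))).card =
      (Fintype.card F - 1) * (δ * (Fintype.card F + 1)) := by
    have h1 := card_filter_holes_add_sum T hSd ⊤
    simp only [Submodule.mem_top, Finset.filter_true, finrank_top, hV] at h1
    have h2 : ∀ l ∈ T, (Fintype.card F : ℤ) ^ Module.finrank F ↥(l ⊓ ⊤) - 1 =
        (Fintype.card F : ℤ) ^ 2 - 1 := fun l hl => by rw [inf_top_eq, hS2 l hl]
    rw [Finset.sum_congr rfl h2, Finset.sum_const, nsmul_eq_mul] at h1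
    have hle : 1 ≤ Fintype.card F := hprime.one_le
    have hle2 : 1 ≤ Fintype.card F ^ 2 := Nat.one_le_pow _ _ hle
    have hlem : 1 ≤ Fintype.card F ^ (2 * m + 2) := Nat.one_le_pow _ _ hle
    zify [hle2, hlem] at hdef'
    zify [hle]
    linear_combination h1 - hdef'
  obtain ⟨W, hW2, hW⟩ := exists_line_of_card_hyperplane_sections hprime (by omega)
    (holes (T : Set (Submodule F (Fin (2 * m + 1 + 1) → F)))) (by simp [mem_holes])
    (fun v hv a ha => by
      rw [mem_holes] at hv ⊢
      exact ⟨smul_ne_zero ha hv.1, fun l hl h => hv.2 l hl ((l.smul_mem_iff ha).mp h)⟩)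
    δ hδpos hδ hcard
    (exists_card_filter_holes_eq T hS2 hSd m δ hV (by
      have : Fintype.card F ≠ 2 := by rintro h; rw [h] at hodd; exact absurd hodd (by decide)
      omega) hdef')
  obtain ⟨l, hl, hWl⟩ := hmax W hW2
  obtain ⟨w, hw, hw0⟩ := Submodule.exists_mem_ne_zero_of_ne_bot hWl
  exact (mem_holes.mp (hW w hw.1 hw0)).2 l hl hw.2
end

section
/- Let q = p^h with p prime, h odd, h > 2, and N ≥ 3 odd. If S is a maximal partial line spread of PG(N,q) of deficiency δ > 0, i.e. |S| = (q^{N+1}−1)/(q^2−1) − δ with δ > 0, then δ ≥ c_p·q^{2/3} + 1, where c_2 = c_3 = 2^{−1/3} and c_p = 1 for p > 3. -/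
section

open Polynomial

/-- If `N` vanishes at every root of a split polynomial `f`, then `f` divides `N * f'`. -/
theorem Polynomial.Splits.dvd_mul_derivative {F : Type*} [Field F] {f N : F[X]} (hf : f.Splits)
    (hN : ∀ x, f.IsRoot x → N.IsRoot x) : f ∣ N * derivative f := by
  classical
  by_cases h0 : N * derivative f = 0
  · simp [h0]
  have hf0 : f ≠ 0 := by rintro rfl; simp at h0
  refine hf.dvd_of_roots_le_roots hf0 ?_
  rw [Multiset.le_iff_count]
  intro x
  rw [count_roots, count_roots, rootMultiplicity_mul h0]
  by_cases hx : f.IsRoot x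
  · have h1 := (rootMultiplicity_pos (left_ne_zero_of_mul h0)).2 (hN x hx)
    have h2 := rootMultiplicity_sub_one_le_derivative_rootMultiplicity_of_ne_zero f x
      (right_ne_zero_of_mul h0)
    omega
  · rw [rootMultiplicity_eq_zero hx]; omega

/-- The degree inequality for a split lacunary polynomial `X ^ Q * g + h`. -/
theorem lacunary_degree_lt {F : Type*} [Field F] {g h N : F[X]} {Q : ℕ} (hQ : (Q : F) = 0)
    (hgh : IsCoprime g h) (hg : g ≠ 0) (hhQ : h.natDegree < Q)
    (hd : ¬ (derivative g = 0 ∧ derivative h = 0)) (hsplit : (X ^ Q * g + h).Splits)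
    (hN0 : N ≠ 0) (hN : ∀ x, (X ^ Q * g + h).IsRoot x → N.IsRoot x) :
    Q < N.natDegree + h.natDegree := by
  have hW : wronskian g h ≠ 0 := fun h0 => hd (hgh.wronskian_eq_zero_iff.1 h0)
  have hdvd : X ^ Q * g + h ∣ N * wronskian g h := by
    have h1 := hsplit.dvd_mul_derivative hN
    have : N * wronskian g h = N * derivative (X ^ Q * g + h) * g
        - (X ^ Q * g + h) * (N * derivative g) := by
      simp [wronskian, derivative_X_pow, hQ]
      ring
    rw [this]
    exact dvd_sub (h1.mul_right _) (dvd_mul_right _ _)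
  have h2 := natDegree_le_of_dvd hdvd (mul_ne_zero hN0 hW)
  rw [natDegree_mul hN0 hW] at h2
  have h3 := natDegree_wronskian_lt_add hW
  have h4 : (X ^ Q * g).natDegree = Q + g.natDegree := by
    rw [natDegree_mul (pow_ne_zero _ X_ne_zero) hg, natDegree_X_pow]
  rw [natDegree_add_eq_left_of_natDegree_lt (by omega), h4] at h2
  omega

/-- The homogenisation of `A` to degree `k`, evaluated at `(U, V)`. -/
noncomputable def homEval {F : Type*} [Field F] (k : ℕ) (A U V : F[X]) : F[X] :=
  ∑ i ∈ Finset.range (k + 1), C (A.coeff i) * U ^ i * V ^ (k - i)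

theorem map_homEval {F K : Type*} [Field F] [Field K] {k : ℕ} {A U V : F[X]}
    (hA : A.natDegree ≤ k) (i : F →+* K) (j : F[X] →+* K) (hij : ∀ c, j (C c) = i c) (y : K)
    (hy : j V * y = j U) : j (homEval k A U V) = j V ^ k * A.eval₂ i y := by
  rw [homEval, map_sum, eval₂_eq_sum_range' i (Nat.lt_succ_of_le hA), Finset.mul_sum]
  refine Finset.sum_congr rfl fun m hm => ?_
  have hm : m ≤ k := Nat.lt_succ_iff.1 (Finset.mem_range.1 hm)
  rw [map_mul, map_mul, map_pow, map_pow, hij, ← hy, mul_pow,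
    ← Nat.add_sub_of_le hm, Nat.add_sub_cancel_left, pow_add]
  ring

theorem natDegree_homEval_le {F : Type*} [Field F] {k d : ℕ} {A U V : F[X]}
    (hU : U.natDegree ≤ d) (hV : V.natDegree ≤ d) : (homEval k A U V).natDegree ≤ k * d := by
  refine natDegree_sum_le_of_forall_le _ _ fun m hm => ?_
  have hm : m ≤ k := Nat.lt_succ_iff.1 (Finset.mem_range.1 hm)
  calc _ ≤ (C (A.coeff m) * U ^ m).natDegree + (V ^ (k - m)).natDegree := natDegree_mul_le
    _ ≤ m * d + (k - m) * d := by
      gcongr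
      · exact (natDegree_C_mul_le _ _).trans (natDegree_pow_le_of_le m hU)
      · exact natDegree_pow_le_of_le _ hV
    _ = k * d := by rw [← Nat.add_mul, Nat.add_sub_of_le hm]

theorem mul_derivative_homEval {F : Type*} [Field F] (k : ℕ) (A U V : F[X]) :
    V * derivative (homEval (k + 1) A U V) =
      homEval k (derivative A) U V * wronskian V U
        + (k + 1 : F[X]) * homEval (k + 1) A U V * derivative V := by
  have h1 : homEval k (derivative A) U V * wronskian V U =
      ∑ i ∈ Finset.range (k + 2), C (A.coeff i) * (i : F[X]) * U ^ (i - 1) * V ^ (k + 1 - i)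
        * wronskian V U := by
    rw [Finset.sum_range_succ', homEval, Finset.sum_mul]
    simp only [Nat.cast_zero, mul_zero, zero_mul, add_zero]
    refine Finset.sum_congr rfl fun m _ => ?_
    rw [coeff_derivative]
    simp
  rw [h1, homEval, derivative_sum, Finset.mul_sum, Finset.mul_sum, Finset.sum_mul,
    ← Finset.sum_add_distrib]
  refine Finset.sum_congr rfl fun m hm => ?_
  obtain ⟨r, hr⟩ := Nat.exists_eq_add_of_le (Nat.lt_succ_iff.1 (Finset.mem_range.1 hm))
  rw [hr, Nat.add_sub_cancel_left]
  have hc : (k : F[X]) + 1 = m + r := by exact_mod_cast congrArg (Nat.cast (R := F[X])) hr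
  rw [hc]
  rcases m with _ | m <;> rcases r with _ | r <;>
    simp [wronskian, derivative_pow] <;> ring

/-- A nonconstant quotient of coprime polynomials is transcendental. -/
theorem eval₂_quotient_ne_zero {F : Type*} [Field F] {U V P : F[X]} (hUV : IsCoprime V U)
    (hV : V ≠ 0) (hd : ¬ (derivative V = 0 ∧ derivative U = 0)) (hP : P ≠ 0) :
    P.eval₂ (algebraMap F (FractionRing F[X]))
      (algebraMap F[X] (FractionRing F[X]) U / algebraMap F[X] (FractionRing F[X]) V) ≠ 0 := by
  intro h0
  set K := FractionRing F[X]
  set R : K := algebraMap F[X] K U / algebraMap F[X] K V with hR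
  have hinj := IsFractionRing.injective F[X] K
  have hVK : algebraMap F[X] K V ≠ 0 := by rwa [Ne, map_eq_zero_iff _ hinj]
  have halg : IsIntegral F R := (isAlgebraic_iff_isIntegral).1 ⟨P, hP, h0⟩
  have hint : IsIntegral F[X] R := halg.tower_top
  obtain ⟨r, hr⟩ := (IsIntegrallyClosed.isIntegral_iff).1 hint
  have hU : U = V * r := by
    apply hinj
    rw [map_mul, hr, hR, mul_div_cancel₀ _ hVK]
  have hVu : IsUnit V := hUV.isUnit_of_dvd' dvd_rfl (hU ▸ dvd_mul_right _ _)
  have hcomp : P.comp r = 0 := by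
    apply hinj
    rw [comp, hom_eval₂, hr, map_zero, ← h0]
    rfl
  obtain ⟨c, -, rfl⟩ := Polynomial.isUnit_iff.1 hVu
  rcases comp_eq_zero_iff.1 hcomp with h | ⟨-, h⟩
  · exact hP h
  · apply hd
    rw [hU, h, ← C_mul]
    simp

/-- The composition of two rational functions with nonzero derivative is not a `p`-th power
of the variable. -/
theorem X_pow_mul_homEval_add_ne_zero {F : Type*} [Field F] {A B U V : F[X]} {k J : ℕ}
    (hJ : (J : F) = 0) (hA : A.natDegree ≤ k + 1) (hB : B.natDegree ≤ k + 1)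
    (hUV : IsCoprime V U) (hV : V ≠ 0) (hd : ¬ (derivative V = 0 ∧ derivative U = 0))
    (hAB : wronskian A B ≠ 0) :
    X ^ J * homEval (k + 1) A U V + homEval (k + 1) B U V ≠ 0 := by
  intro h0
  have hW : wronskian V U ≠ 0 := fun h0 => hd (hUV.wronskian_eq_zero_iff.1 h0)
  have h1 : X ^ J * homEval k (derivative A) U V + homEval k (derivative B) U V = 0 := by
    have h2 := congrArg derivative h0
    simp only [derivative_add, derivative_mul, derivative_X_pow, hJ, map_zero, zero_mul, zero_add]
      at h2
    have h3 := mul_derivative_homEval k A U V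
    have h4 := mul_derivative_homEval k B U V
    refine (mul_eq_zero.1 ?_).resolve_right hW
    linear_combination V * h2 - X ^ J * h3 - h4 - (k + 1 : F[X]) * derivative V * h0
  refine eval₂_quotient_ne_zero hUV hV hd hAB ?_
  set K := FractionRing F[X]
  have hinj := IsFractionRing.injective F[X] K
  have hVK : algebraMap F[X] K V ≠ 0 := by rwa [Ne, map_eq_zero_iff _ hinj]
  have hy := mul_div_cancel₀ (algebraMap F[X] K U) hVK
  set R : K := algebraMap F[X] K U / algebraMap F[X] K V
  have key : ∀ (l : ℕ) (P : F[X]), P.natDegree ≤ l → algebraMap F[X] K (homEval l P U V) =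
      algebraMap F[X] K V ^ l * P.eval₂ (algebraMap F K) R := fun l P hl =>
    map_homEval hl (algebraMap F K) (algebraMap F[X] K) (fun c => rfl) R hy
  have e0 := congrArg (algebraMap F[X] K) h0
  have e1 := congrArg (algebraMap F[X] K) h1
  rw [map_add, map_mul, map_zero, key _ _ hA, key _ _ hB] at e0
  rw [map_add, map_mul, map_zero,
    key _ _ ((natDegree_derivative_le A).trans (by omega)),
    key _ _ ((natDegree_derivative_le B).trans (by omega))] at e1
  have e0' : algebraMap F[X] K (X ^ J) * A.eval₂ (algebraMap F K) R
      + B.eval₂ (algebraMap F K) R = 0 := by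
    refine (mul_eq_zero.1 ?_).resolve_left (pow_ne_zero (k + 1) hVK)
    linear_combination e0
  have e1' : algebraMap F[X] K (X ^ J) * (derivative A).eval₂ (algebraMap F K) R
      + (derivative B).eval₂ (algebraMap F K) R = 0 := by
    refine (mul_eq_zero.1 ?_).resolve_left (pow_ne_zero k hVK)
    linear_combination e1
  rw [wronskian, eval₂_sub, eval₂_mul, eval₂_mul]
  linear_combination A.eval₂ (algebraMap F K) R * e1' -
    (derivative A).eval₂ (algebraMap F K) R * e0'

theorem lacunary_arith_separable {c p q k : ℕ} (hc : c = 2 ∧ 2 ≤ p ∨ c = 1 ∧ 5 ≤ p)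
    (hq : p ^ 3 ≤ q) (hk : c * k ^ 3 < q ^ 2) : 2 * k < q := by
  by_contra! h
  have h1 : q ^ 3 ≤ (2 * k) ^ 3 := Nat.pow_le_pow_left h 3
  have h2 : c * q ^ 3 < 8 * q ^ 2 := by
    calc c * q ^ 3 ≤ c * (2 * k) ^ 3 := by gcongr
      _ = 8 * (c * k ^ 3) := by ring
      _ < 8 * q ^ 2 := by omega
  have h3 : c * q < 8 := by
    by_contra! h4
    have : 8 * q ^ 2 ≤ c * q * q ^ 2 := by gcongr
    nlinarith
  rcases hc with ⟨rfl, hp⟩ | ⟨rfl, hp⟩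
  · have : 2 ^ 3 ≤ p ^ 3 := Nat.pow_le_pow_left hp 3
    omega
  · have : 5 ^ 3 ≤ p ^ 3 := Nat.pow_le_pow_left hp 3
    omega

theorem lacunary_arith_third {c p E Q k : ℕ} (hc : c = 2 ∧ 2 ≤ p ∨ c = 1 ∧ 5 ≤ p)
    (hE : p ≤ E) (hQ : Q = E ^ 2 ∨ p * E ^ 2 ≤ Q) (hk : c * (E * k) ^ 3 < (E * Q) ^ 2) :
    (E + 1) * k < Q := by
  by_contra! h
  have hc1 : 1 ≤ c := by omega
  have hE2 : 2 ≤ E := by omega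
  have hk' : c * (E * k ^ 3) < Q ^ 2 := by
    by_contra! h4
    have : E ^ 2 * Q ^ 2 ≤ E ^ 2 * (c * (E * k ^ 3)) := by gcongr
    nlinarith
  rcases hQ with rfl | hQ
  · have h1 : E ≤ k := by
      by_contra! h1
      have : (E + 1) * k ≤ (E + 1) * (E - 1) := by gcongr; omega
      obtain ⟨m, rfl⟩ : ∃ m, E = m + 1 := ⟨E - 1, by omega⟩
      simp only [Nat.add_sub_cancel] at this
      nlinarith
    have h2 : E * E ^ 3 ≤ c * (E * k ^ 3) := by
      calc E * E ^ 3 ≤ 1 * (E * k ^ 3) := by rw [one_mul]; gcongr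
        _ ≤ c * (E * k ^ 3) := by gcongr
    nlinarith
  · have h1 : Q ^ 3 ≤ ((E + 1) * k) ^ 3 := Nat.pow_le_pow_left h 3
    have h2 : c * E * Q ^ 3 < (E + 1) ^ 3 * Q ^ 2 := by
      calc c * E * Q ^ 3 ≤ c * E * ((E + 1) * k) ^ 3 := by gcongr
        _ = (E + 1) ^ 3 * (c * (E * k ^ 3)) := by ring
        _ < (E + 1) ^ 3 * Q ^ 2 := by gcongr
    have h3 : c * E * Q < (E + 1) ^ 3 := by
      by_contra! h4
      have : (E + 1) ^ 3 * Q ^ 2 ≤ c * E * Q * Q ^ 2 := by gcongr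
      nlinarith
    have h4 : 4 ≤ c * p := by rcases hc with ⟨rfl, hp⟩ | ⟨rfl, hp⟩ <;> omega
    have h5 : 4 * E ^ 3 ≤ c * E * Q := by
      calc 4 * E ^ 3 ≤ c * p * E ^ 3 := by gcongr
        _ = c * E * (p * E ^ 2) := by ring
        _ ≤ c * E * Q := by gcongr
    nlinarith [mul_le_mul hE2 hE2 (by omega) (by omega), Nat.pow_le_pow_left hE2 3]

theorem lacunary_arith_below_half {c p E J k : ℕ} (hc : c = 2 ∧ 2 ≤ p ∨ c = 1 ∧ 5 ≤ p)
    (hJ : p ≤ J) (hE : p * J ≤ E) (hk : c * (E * k) ^ 3 < (E * (E * J)) ^ 2) :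
    J + k ^ 2 + k ≤ E * J := by
  by_contra! h
  have hE0 : 0 < E := by
    have : 0 < p * J := Nat.mul_pos (by omega) (by omega)
    omega
  have hk' : c * k ^ 3 < E * J ^ 2 := by
    by_contra! h4
    have : E ^ 3 * (E * J ^ 2) ≤ E ^ 3 * (c * k ^ 3) := by gcongr
    nlinarith
  have h6 : (c * k ^ 3) ^ 2 < (E * J ^ 2) ^ 2 := Nat.pow_lt_pow_left hk' (by omega)
  have h7 : p * (c ^ 2 * k ^ 6) < (E * J) ^ 3 := by
    calc p * (c ^ 2 * k ^ 6) = p * (c * k ^ 3) ^ 2 := by ring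
      _ < p * (E * J ^ 2) ^ 2 := by gcongr; omega
      _ = p * J * (E ^ 2 * J ^ 3) := by ring
      _ ≤ E * (E ^ 2 * J ^ 3) := by gcongr
      _ = (E * J) ^ 3 := by ring
  set T := E * J with hT
  rcases hc with ⟨rfl, hp⟩ | ⟨rfl, hp⟩
  · have h8 : 2 * k ^ 2 < T := by
      refine lt_of_pow_lt_pow_left₀ 3 (by omega) ?_
      calc (2 * k ^ 2) ^ 3 = 2 * (2 ^ 2 * k ^ 6) := by ring
        _ ≤ p * (2 ^ 2 * k ^ 6) := by gcongr
        _ < T ^ 3 := h7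
    have h9 : 4 * J ≤ T := by rw [hT]; gcongr; nlinarith
    nlinarith
  · have h8 : 5 * k ^ 2 < 3 * T := by
      refine lt_of_pow_lt_pow_left₀ 3 (by omega) ?_
      calc (5 * k ^ 2) ^ 3 = 25 * (5 * (1 ^ 2 * k ^ 6)) := by ring
        _ ≤ 25 * (p * (1 ^ 2 * k ^ 6)) := by gcongr
        _ < 25 * T ^ 3 := by omega
        _ ≤ (3 * T) ^ 3 := by nlinarith [Nat.zero_le (T ^ 3)]
    have h9 : 25 * J ≤ T := by rw [hT]; gcongr; nlinarith
    nlinarith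

theorem lacunary_arith_above_half {c p Q J k : ℕ} (hc : c = 2 ∧ 2 ≤ p ∨ c = 1 ∧ 5 ≤ p)
    (hJ : p ≤ J) (hQ : p * J ≤ Q) (hk1 : 1 ≤ k)
    (hk : c * (Q * J * k) ^ 3 < (Q * J * Q) ^ 2) : 1 + J * k ^ 2 + k ≤ Q := by
  by_contra! h
  have hk' : c * J * k ^ 3 < Q := by
    by_contra! h4
    have : Q ^ 3 * J ^ 2 * Q ≤ Q ^ 3 * J ^ 2 * (c * J * k ^ 3) := by gcongr
    nlinarith
  have h1 : k ≤ J * k ^ 2 := by nlinarith [Nat.mul_le_mul (show 1 ≤ J by omega) hk1]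
  rcases hc with ⟨rfl, hp⟩ | ⟨rfl, hp⟩
  · have h2 : J * k ^ 2 * 1 ≤ J * k ^ 2 * k := by gcongr
    nlinarith
  · obtain rfl | hk2 : k = 1 ∨ 2 ≤ k := by omega
    · nlinarith
    · have h2 : J * k ^ 2 * 2 ≤ J * k ^ 2 * k := by gcongr
      nlinarith

theorem lacunary_const_cases {p : ℕ} (hp : p.Prime) :
    (if p ≤ 3 then 2 else 1) = 2 ∧ 2 ≤ p ∨ (if p ≤ 3 then 2 else 1) = 1 ∧ 5 ≤ p := by
  split_ifs with h3
  · exact Or.inl ⟨rfl, hp.two_le⟩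
  · refine Or.inr ⟨rfl, ?_⟩
    have : p ≠ 4 := by rintro rfl; revert hp; decide
    omega

theorem two_mul_lt_of_lacunary_bound {p n k : ℕ} (hp : p.Prime) (hn : 3 ≤ n)
    (hk : (if p ≤ 3 then 2 else 1) * k ^ 3 < (p ^ n) ^ 2) : 2 * k < p ^ n :=
  lacunary_arith_separable (lacunary_const_cases hp) (Nat.pow_le_pow_right hp.pos hn) hk

theorem exists_eq_pow_of_derivative_eq_zero {F : Type*} [Field F] {p : ℕ} [Fact p.Prime]
    [CharP F p] [PerfectRing F p] {f : F[X]} (hf : derivative f = 0) : ∃ f₁ : F[X], f = f₁ ^ p := by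
  refine ⟨(contract p f).map (frobeniusEquiv F p).symm, ?_⟩
  rw [← polynomial_expand_eq, expand_contract p hf (Fact.out : p.Prime).ne_zero]

theorem X_mul_pow_add_pow_ne_zero {F : Type*} [Field F] {G H : F[X]} {E : ℕ} (hE : E ≠ 0)
    (hEF : (E : F) = 0) (hGH : ¬ (G = 0 ∧ H = 0)) : X * G ^ E + H ^ E ≠ 0 := by
  intro h0
  have h1 := congrArg derivative h0
  simp only [derivative_add, derivative_mul, derivative_pow, hEF, derivative_X, map_zero, one_mul,
    zero_mul, mul_zero, add_zero] at h1
  have hG := (pow_eq_zero_iff hE).1 h1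
  rw [hG, zero_pow hE, mul_zero, zero_add] at h0
  exact hGH ⟨hG, (pow_eq_zero_iff hE).1 h0⟩

/-- If `x` is a root of `X ^ Q * g + h`, then applying the relation `x ^ Q = - h x / g x` twice
gives a relation for `x ^ (Q ^ 2)`. -/
theorem homEval_twist_relation {F : Type*} [Field F] {p m k : ℕ} [Fact p.Prime] [CharP F p]
    {g h : F[X]} (hg : g.natDegree ≤ k) (hh : h.natDegree ≤ k) {x : F}
    (hx : (X ^ p ^ m * g + h).IsRoot x) :
    (x ^ p ^ m) ^ p ^ m * (homEval k (g.map (iterateFrobenius F p m)) (-h) g).eval x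
      + (homEval k (h.map (iterateFrobenius F p m)) (-h) g).eval x = 0 := by
  have hx' : x ^ p ^ m * g.eval x + h.eval x = 0 := by simpa [IsRoot] using hx
  have hy : evalRingHom x g * iterateFrobenius F p m x = evalRingHom x (-h) := by
    simp only [coe_evalRingHom, eval_neg, iterateFrobenius_def]
    linear_combination hx'
  have key : ∀ P : F[X], P.natDegree ≤ k →
      (homEval k (P.map (iterateFrobenius F p m)) (-h) g).eval x
        = g.eval x ^ k * iterateFrobenius F p m (P.eval x) := by
    intro P hP
    have := map_homEval (A := P.map (iterateFrobenius F p m)) (natDegree_map_le.trans hP)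
      (RingHom.id F) (evalRingHom x) (fun c => by simp) _ hy
    rw [coe_evalRingHom] at this
    rw [this, eval₂_map, RingHom.id_comp, eval₂_at_apply]
  rw [key g hg, key h hh]
  have h2 := congrArg (iterateFrobenius F p m) hx'
  rw [map_add, map_mul, map_zero, iterateFrobenius_def p m (x ^ p ^ m)] at h2
  linear_combination g.eval x ^ k * h2

/-- A split lacunary polynomial `X ^ q * g + h` with `g`, `h` coprime of small degree over the field
of order `q` is either `(X ^ q - X) * g` or the `q`-th power of a linear polynomial. -/
theorem lacunary_dichotomy {F : Type*} [Field F] [Fintype F] {p n k : ℕ} [Fact p.Prime]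
    [CharP F p] (hcard : Fintype.card F = p ^ n) (hn : Odd n) (hn3 : 3 ≤ n) {g h : F[X]}
    (hgh : IsCoprime g h) (hg : g ≠ 0) (hgk : g.natDegree ≤ k) (hhk : h.natDegree ≤ k)
    (hk : (if p ≤ 3 then 2 else 1) * k ^ 3 < (p ^ n) ^ 2) (hs : (X ^ p ^ n * g + h).Splits) :
    X * g + h = 0 ∨ ∃ a b : F, a ≠ 0 ∧ X ^ p ^ n * g + h = (C a * X + C b) ^ p ^ n := by
  classical
  have hp : p.Prime := Fact.out
  set c := if p ≤ 3 then 2 else 1 with hcdef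
  have hc : c = 2 ∧ 2 ≤ p ∨ c = 1 ∧ 5 ≤ p := lacunary_const_cases hp
  have hp2 := hp.two_le
  have hpow : ∀ m, m ≠ 0 → ((p ^ m : ℕ) : F) = 0 := fun m hm => by simp [hm]
  have hFq : ∀ x : F, x ^ p ^ n = x := fun x => hcard ▸ FiniteField.pow_card x
  have hkq : 2 * k < p ^ n := two_mul_lt_of_lacunary_bound hp hn3 hk
  obtain ⟨e, hen, ⟨g₁, h₁, rfl, rfl⟩, hmax⟩ :
      ∃ e ≤ n, (∃ g₁ h₁ : F[X], g = g₁ ^ p ^ e ∧ h = h₁ ^ p ^ e) ∧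
        ∀ m, e < m → m ≤ n → ¬ ∃ g₁ h₁ : F[X], g = g₁ ^ p ^ m ∧ h = h₁ ^ p ^ m := by
    let P : ℕ → Prop := fun e => ∃ g₁ h₁ : F[X], g = g₁ ^ p ^ e ∧ h = h₁ ^ p ^ e
    exact ⟨Nat.findGreatest P n, Nat.findGreatest_le n,
      Nat.findGreatest_spec (P := P) (Nat.zero_le n) ⟨g, h, by simp, by simp⟩,
      fun m => Nat.findGreatest_is_greatest (P := P)⟩
  have hE0 : p ^ e ≠ 0 := pow_ne_zero _ hp.ne_zero
  have hg₁ : g₁ ≠ 0 := by rintro rfl; exact hg (zero_pow hE0)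
  rw [natDegree_pow] at hgk hhk
  obtain rfl | hen := hen.eq_or_lt
  · right
    have hconst : ∀ f : F[X], p ^ e * f.natDegree ≤ k → ∃ a, f = C a := by
      intro f hf
      refine ⟨f.coeff 0, eq_C_of_natDegree_eq_zero ?_⟩
      by_contra h0
      have : p ^ e * 1 ≤ p ^ e * f.natDegree := by gcongr; omega
      omega
    obtain ⟨a, rfl⟩ := hconst g₁ hgk
    obtain ⟨b, rfl⟩ := hconst h₁ hhk
    refine ⟨a, b, by rintro rfl; simp at hg₁, ?_⟩
    rw [add_pow_char_pow, mul_pow, mul_comm]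
  have hcop : IsCoprime g₁ h₁ := (IsCoprime.pow_iff (by omega) (by omega)).1 hgh
  have hd : ¬ (derivative g₁ = 0 ∧ derivative h₁ = 0) := by
    rintro ⟨hg', hh'⟩
    obtain ⟨g₂, rfl⟩ := exists_eq_pow_of_derivative_eq_zero (p := p) hg'
    obtain ⟨h₂, rfl⟩ := exists_eq_pow_of_derivative_eq_zero (p := p) hh'
    exact hmax (e + 1) (by omega) hen
      ⟨g₂, h₂, by rw [← pow_mul, pow_succ'], by rw [← pow_mul, pow_succ']⟩
  have hEQ : p ^ n = p ^ e * p ^ (n - e) := by rw [← pow_add]; congr 1; omega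
  have hf : X ^ p ^ n * g₁ ^ p ^ e + h₁ ^ p ^ e = (X ^ p ^ (n - e) * g₁ + h₁) ^ p ^ e := by
    rw [add_pow_char_pow, mul_pow, ← pow_mul, mul_comm (p ^ (n - e)), ← hEQ]
  have hs₁ : (X ^ p ^ (n - e) * g₁ + h₁).Splits := by
    rw [hf] at hs
    by_cases h0 : X ^ p ^ (n - e) * g₁ + h₁ = 0
    · rw [h0]; exact Splits.zero
    · exact hs.of_dvd (pow_ne_zero _ h0) (dvd_pow_self _ hE0)
  obtain ⟨k₁, hk₁⟩ : ∃ k₁, k₁ = max g₁.natDegree h₁.natDegree := ⟨_, rfl⟩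
  have hgk₁ : g₁.natDegree ≤ k₁ := hk₁ ▸ le_max_left _ _
  have hhk₁ : h₁.natDegree ≤ k₁ := hk₁ ▸ le_max_right _ _
  have hkk : p ^ e * k₁ ≤ k := by
    rw [hk₁]; rcases max_cases g₁.natDegree h₁.natDegree with h | h <;> rw [h.1] <;> assumption
  have hk₁pos : 1 ≤ k₁ := by
    by_contra h0
    have h1 : g₁.natDegree = 0 := by omega
    have h2 : h₁.natDegree = 0 := by omega
    refine hd ⟨?_, ?_⟩
    · rw [eq_C_of_natDegree_eq_zero h1, derivative_C]
    · rw [eq_C_of_natDegree_eq_zero h2, derivative_C]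
  have hk' : c * (p ^ e * k₁) ^ 3 < (p ^ e * p ^ (n - e)) ^ 2 := by
    rw [← hEQ]
    refine lt_of_le_of_lt ?_ hk
    gcongr
  have hQF := hpow (n - e) (by omega)
  have hroot : ∀ x, (X ^ p ^ (n - e) * g₁ + h₁).IsRoot x →
      (X * g₁ ^ p ^ e + h₁ ^ p ^ e).IsRoot x := by
    intro x hx
    have h1 : (X ^ p ^ n * g₁ ^ p ^ e + h₁ ^ p ^ e).eval x = 0 := by
      rw [hf, eval_pow, hx.eq_zero, zero_pow hE0]
    simpa [IsRoot, hFq] using h1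
  have hhQ : h₁.natDegree < p ^ (n - e) := by
    have h1 : p ^ e * k₁ < p ^ e * p ^ (n - e) := by omega
    exact hhk₁.trans_lt (lt_of_mul_lt_mul_left h1 (Nat.zero_le _))
  obtain rfl | he0 := Nat.eq_zero_or_pos e
  · left
    by_contra h0
    have h1 := lacunary_degree_lt hQF hcop hg₁ hhQ hd hs₁ h0 hroot
    have h2 : (X * g₁ ^ p ^ 0 + h₁ ^ p ^ 0).natDegree ≤ 1 + k₁ := by
      simp only [pow_zero, pow_one]
      compute_degree
      omega
    simp only [pow_zero, one_mul, Nat.sub_zero] at *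
    omega
  exfalso
  have hpE : p ≤ p ^ e := Nat.le_self_pow (by omega) p
  have hEF := hpow e (by omega)
  rcases le_or_gt (3 * e) n with h3 | h3
  · have h1 := lacunary_degree_lt hQF hcop hg₁ hhQ hd hs₁
      (X_mul_pow_add_pow_ne_zero hE0 hEF fun h => hg₁ h.1) hroot
    have h2 : (X * g₁ ^ p ^ e + h₁ ^ p ^ e).natDegree ≤ 1 + p ^ e * k₁ := by
      refine (natDegree_add_le _ _).trans (max_le ?_ ?_)
      · refine natDegree_mul_le.trans (add_le_add natDegree_X_le ?_)
        exact natDegree_pow_le_of_le _ hgk₁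
      · exact (natDegree_pow_le_of_le _ hhk₁).trans (by omega)
    have h4 := lacunary_arith_third hc hpE (Q := p ^ (n - e)) ?_ hk'
    · rw [Nat.add_mul, one_mul] at h4
      omega
    · obtain h5 | h5 : n - e = e * 2 ∨ 1 + e * 2 ≤ n - e := by omega
      · left; rw [h5, pow_mul]
      · right
        rw [← pow_mul, ← pow_succ', add_comm]
        exact Nat.pow_le_pow_right (by omega) h5
  rcases le_or_gt (2 * n) (3 * e) with h4 | h4
  · have h5 : (p ^ e * p ^ (n - e)) ^ 2 ≤ 1 * (p ^ e * 1) ^ 3 := by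
      rw [← hEQ, one_mul, mul_one, ← pow_mul, ← pow_mul]
      exact Nat.pow_le_pow_right (by omega) (by omega)
    have h6 : 1 * (p ^ e * 1) ^ 3 ≤ c * (p ^ e * k₁) ^ 3 := by
      gcongr
      omega
    omega
  obtain ⟨r, rfl⟩ : ∃ r, k₁ = r + 1 := ⟨k₁ - 1, by omega⟩
  set σ := iterateFrobenius F p (n - e)
  have hWσ : wronskian (g₁.map σ) (h₁.map σ) ≠ 0 := by
    have h1 : wronskian g₁ h₁ ≠ 0 := fun h0 => hd (hcop.wronskian_eq_zero_iff.1 h0)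
    have h2 : wronskian (g₁.map σ) (h₁.map σ) = (wronskian g₁ h₁).map σ := by
      simp [wronskian, derivative_map]
    rwa [h2, Ne, Polynomial.map_eq_zero]
  set G := homEval (r + 1) (g₁.map σ) (-h₁) g₁
  set H := homEval (r + 1) (h₁.map σ) (-h₁) g₁
  have hne : ∀ J : ℕ, (J : F) = 0 → X ^ J * G + H ≠ 0 := fun J hJ =>
    X_pow_mul_homEval_add_ne_zero hJ (natDegree_map_le.trans hgk₁) (natDegree_map_le.trans hhk₁)
      hcop.neg_right hg₁ (by simpa using hd) hWσ
  have hGdeg : G.natDegree ≤ (r + 1) * (r + 1) :=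
    natDegree_homEval_le (by rwa [natDegree_neg]) hgk₁
  have hHdeg : H.natDegree ≤ (r + 1) * (r + 1) :=
    natDegree_homEval_le (by rwa [natDegree_neg]) hgk₁
  have hrel := fun x (hx : (X ^ p ^ (n - e) * g₁ + h₁).IsRoot x) =>
    homEval_twist_relation hgk₁ hhk₁ hx
  have hn2 : 2 * e ≠ n := by rintro rfl; exact (Nat.not_odd_iff_even.2 (even_two_mul e)) hn
  rcases lt_or_gt_of_ne hn2 with h2 | h2
  · have hJ : p ^ (n - e) = p ^ e * p ^ (n - 2 * e) := by rw [← pow_add]; congr 1; omega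
    have h1 := lacunary_degree_lt hQF hcop hg₁ hhQ hd hs₁ (hne _ (hpow (n - 2 * e) (by omega))) ?_
    · have h5 : (X ^ p ^ (n - 2 * e) * G + H).natDegree ≤
          p ^ (n - 2 * e) + (r + 1) * (r + 1) := by
        refine (natDegree_add_le _ _).trans (max_le ?_ (by omega))
        exact natDegree_mul_le.trans (add_le_add (natDegree_X_pow_le _) hGdeg)
      rw [hJ] at hk'
      have h6 := lacunary_arith_below_half hc (Nat.le_self_pow (by omega) p) ?_ hk'
      · rw [← hJ, sq] at h6
        omega
      · rw [← pow_succ']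
        exact Nat.pow_le_pow_right (by omega) (by omega)
    · intro x hx
      have h5 := hrel x hx
      have h6 : (x ^ p ^ (n - e)) ^ p ^ (n - e) = x ^ p ^ (n - 2 * e) := by
        rw [← pow_mul, ← pow_add, show n - e + (n - e) = n + (n - 2 * e) by omega, pow_add,
          pow_mul, hFq]
      rw [h6] at h5
      simpa [IsRoot] using h5
  · have hJ : p ^ e = p ^ (n - e) * p ^ (2 * e - n) := by rw [← pow_add]; congr 1; omega
    have hJ0 : p ^ (2 * e - n) ≠ 0 := pow_ne_zero _ hp.ne_zero
    have h1 := lacunary_degree_lt (N := X * G ^ p ^ (2 * e - n) + H ^ p ^ (2 * e - n))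
      hQF hcop hg₁ hhQ hd hs₁
      (X_mul_pow_add_pow_ne_zero hJ0 (hpow (2 * e - n) (by omega)) ?_) ?_
    · have h5 : (X * G ^ p ^ (2 * e - n) + H ^ p ^ (2 * e - n)).natDegree ≤
          1 + p ^ (2 * e - n) * ((r + 1) * (r + 1)) := by
        refine (natDegree_add_le _ _).trans (max_le ?_ ?_)
        · exact natDegree_mul_le.trans
            (add_le_add natDegree_X_le (natDegree_pow_le_of_le _ hGdeg))
        · exact (natDegree_pow_le_of_le _ hHdeg).trans (by omega)
      rw [hJ] at hk'
      have h6 := lacunary_arith_above_half hc (Nat.le_self_pow (by omega) p) ?_ hk₁pos hk'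
      · rw [sq] at h6
        omega
      · rw [← pow_succ']
        exact Nat.pow_le_pow_right (by omega) (by omega)
    · rintro ⟨hG, hH⟩
      exact hne 0 (by simp) (by rw [hG, hH]; simp)
    · intro x hx
      have h5 := congrArg (· ^ p ^ (2 * e - n)) (hrel x hx)
      simp only [zero_pow hJ0] at h5
      rw [add_pow_char_pow, mul_pow, ← pow_mul, ← pow_mul, ← hJ, mul_comm _ (p ^ e),
        ← hEQ, hFq] at h5
      simpa [IsRoot] using h5

/-- **Jamison's bound**: a family of points meeting every line of the affine plane over a field
of order `q` has at least `2 q - 1` members. -/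
theorem two_mul_card_sub_one_lt_of_blocking {F ι : Type*} [Field F] [Fintype F] {s : Finset ι}
    {a b : ι → F} (hline : ∀ m c, ∃ i ∈ s, b i = m * a i + c) (hvert : ∀ c, ∃ i ∈ s, a i = c) :
    2 * (Fintype.card F - 1) < s.card := by
  classical
  obtain ⟨o, ho, -⟩ := hvert 0
  by_contra! hlt
  let f : MvPolynomial (Fin 2) F := ∏ i ∈ s.erase o,
    (1 - (MvPolynomial.C (a i - a o) * MvPolynomial.X 0 +
      MvPolynomial.C (b i - b o) * MvPolynomial.X 1))
  have hdeg : f.totalDegree < (Fintype.card F - 1) * Fintype.card (Fin 2) := by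
    have h1 : f.totalDegree ≤ ∑ i ∈ s.erase o, 1 := by
      refine (MvPolynomial.totalDegree_finsetProd _ _).trans (Finset.sum_le_sum fun i _ => ?_)
      refine (MvPolynomial.totalDegree_sub _ _).trans (max_le (by simp) ?_)
      refine (MvPolynomial.totalDegree_add _ _).trans (max_le ?_ ?_) <;>
        exact (MvPolynomial.totalDegree_mul _ _).trans
          (by rw [MvPolynomial.totalDegree_C, MvPolynomial.totalDegree_X])
    have h2 := Finset.card_erase_lt_of_mem ho
    simp only [Finset.sum_const, smul_eq_mul, mul_one] at h1
    simp only [Fintype.card_fin]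
    omega
  have hsum := MvPolynomial.sum_eval_eq_zero f hdeg
  have heval : ∀ x : Fin 2 → F, MvPolynomial.eval x f =
      ∏ i ∈ s.erase o, (1 - ((a i - a o) * x 0 + (b i - b o) * x 1)) := fun x => by
    simp [f, map_prod]
  rw [Finset.sum_eq_single 0 ?_ (by simp), heval] at hsum
  · simp at hsum
  · intro x _ hx
    rw [heval]
    obtain ⟨i, hi, h1⟩ : ∃ i ∈ s, (a i - a o) * x 0 + (b i - b o) * x 1 = 1 := by
      by_cases hx1 : x 1 = 0
      · have hx0 : x 0 ≠ 0 := by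
          intro hx0
          apply hx
          ext j
          fin_cases j <;> simpa
        obtain ⟨i, hi, h⟩ := hvert ((x 0)⁻¹ + a o)
        exact ⟨i, hi, by rw [h, hx1]; field_simp; ring⟩
      · obtain ⟨i, hi, h⟩ := hline (-(x 0 / x 1)) ((1 + a o * x 0) / x 1 + b o)
        exact ⟨i, hi, by rw [h]; field_simp; ring⟩
    refine Finset.prod_eq_zero (Finset.mem_erase.2 ⟨?_, hi⟩) (sub_eq_zero.2 h1.symm)
    rintro rfl
    simp at h1

theorem X_pow_card_sub_X_dvd {F : Type*} [Field F] [Fintype F] {f : F[X]}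
    (hf : ∀ c, f.IsRoot c) : X ^ Fintype.card F - X ∣ f := by
  by_cases hf0 : f = 0
  · simp [hf0]
  have h1 := FiniteField.roots_X_pow_card_sub_X F
  have hdeg := FiniteField.X_pow_card_sub_X_natDegree_eq F (Fintype.one_lt_card (α := F))
  have hs : (X ^ Fintype.card F - X : F[X]).Splits := by
    rw [splits_iff_card_roots, h1, hdeg]
    rfl
  refine hs.dvd_of_roots_le_roots (FiniteField.X_pow_card_sub_X_ne_zero F Fintype.one_lt_card) ?_
  rw [h1, Multiset.le_iff_subset Finset.univ.nodup]
  intro c _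
  exact (mem_roots hf0).2 (hf c)

/-- The polynomial `∏ (X + r i)` attached to a family meeting all non-vertical lines is lacunary. -/
theorem coeff_prod_X_add_C_eq_zero_of_blocking {F ι : Type*} [Field F] [Fintype F] {s : Finset ι}
    {r b : ι → F} {k t : ℕ} (hs : s.card = Fintype.card F + k)
    (hblock : ∀ m c, ∃ i ∈ s, c + (r i * m - b i) = 0) (hkt : k < t) (ht : t < Fintype.card F) :
    (∏ i ∈ s, (X + C (r i))).coeff t = 0 := by
  set q := Fintype.card F
  have hq1 : 1 < q := Fintype.one_lt_card
  have hvalue : ∀ m, (∏ i ∈ s, (X + C (r i * m - b i))).coeff t = if t = k + 1 then -1 else 0 := by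
    intro m
    set f := ∏ i ∈ s, (X + C (r i * m - b i)) with hf
    have hmonic : f.Monic := monic_prod_of_monic _ _ fun i _ => monic_X_add_C _
    have hfdeg : f.natDegree = q + k := by
      rw [hf, natDegree_prod_of_monic _ _ fun i _ => monic_X_add_C _]
      simpa only [natDegree_X_add_C, Finset.sum_const, smul_eq_mul, mul_one] using hs
    obtain ⟨G, hG⟩ : X ^ q - X ∣ f := by
      refine X_pow_card_sub_X_dvd fun c => ?_
      obtain ⟨i, hi, h⟩ := hblock m c
      rw [IsRoot, hf, eval_prod]
      exact Finset.prod_eq_zero hi (by simpa using h)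
    have hXdeg : (X ^ q - X : F[X]).natDegree = q := FiniteField.X_pow_card_sub_X_natDegree_eq F hq1
    have hXmonic : (X ^ q - X : F[X]).Monic := monic_X_pow_sub (by simpa using hq1)
    have hGmonic : G.Monic := by
      rw [hG] at hmonic
      exact hXmonic.of_mul_monic_left hmonic
    have hGdeg : G.natDegree = k := by
      rw [hG, hXmonic.natDegree_mul hGmonic, hXdeg] at hfdeg
      omega
    obtain ⟨t, rfl⟩ : ∃ t', t = t' + 1 := ⟨t - 1, by omega⟩
    rw [hG, sub_mul, coeff_sub, coeff_X_pow_mul', if_neg (by omega), coeff_X_mul, zero_sub]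
    split_ifs with htk
    · rw [show t = k by omega, ← hGdeg, hGmonic.coeff_natDegree]
    · rw [coeff_eq_zero_of_natDegree_lt (by omega), neg_zero]
  have htcard : t ≤ s.card := by omega
  set j := s.card - t with hj
  let σ : F[X] := ∑ T ∈ s.powersetCard j, ∏ i ∈ T, (C (r i) * X - C (b i))
  have hlin : ∀ i, (C (r i) * X - C (b i)).natDegree ≤ 1 := fun i => by compute_degree
  have hσeval : ∀ m, σ.eval m = if t = k + 1 then -1 else 0 := by
    intro m
    rw [← hvalue m, Finset.prod_X_add_C_coeff _ _ htcard]
    simp [σ, eval_finsetSum, eval_prod, hj]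
  have hσdeg : σ.natDegree ≤ j := by
    refine natDegree_sum_le_of_forall_le _ _ fun T hT => ?_
    refine (natDegree_prod_le _ _).trans ((Finset.sum_le_sum fun i _ => hlin i).trans ?_)
    simp [(Finset.mem_powersetCard.1 hT).2]
  have hσcoeff : σ.coeff j = ∑ T ∈ s.powersetCard j, ∏ i ∈ T, r i := by
    rw [finsetSum_coeff]
    refine Finset.sum_congr rfl fun T hT => ?_
    have := coeff_prod_of_natDegree_le T (fun i => C (r i) * X - C (b i)) 1 fun i _ => hlin i
    rw [(Finset.mem_powersetCard.1 hT).2, mul_one] at this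
    rw [this]
    refine Finset.prod_congr rfl fun i _ => ?_
    simp [coeff_C]
  rw [Finset.prod_X_add_C_coeff _ _ htcard, ← hj, ← hσcoeff]
  have hσC : σ = C (if t = k + 1 then -1 else 0) := by
    rw [← sub_eq_zero]
    refine eq_zero_of_natDegree_lt_card_of_eval_eq_zero' _ Finset.univ (fun x _ => ?_) ?_
    · rw [eval_sub, hσeval, eval_C, sub_self]
    · refine (natDegree_sub_C.le.trans hσdeg).trans_lt ?_
      rw [Finset.card_univ]
      omega
  rw [hσC, coeff_C, if_neg (by omega)]

/-- A small family of points of an affine plane that meets every non-vertical line has many points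
on some vertical line. -/
theorem exists_card_le_fiber_of_blocking {F ι : Type*} [Field F] [Fintype F] [DecidableEq F]
    {p n k : ℕ} (hp : p.Prime) (hcard : Fintype.card F = p ^ n) (hn : Odd n) (hn3 : 3 ≤ n)
    (hk : (if p ≤ 3 then 2 else 1) * k ^ 3 < (p ^ n) ^ 2) {s : Finset ι} {a b : ι → F}
    (hs : s.card ≤ p ^ n + k) (hblock : ∀ m c, ∃ i ∈ s, b i = m * a i + c) :
    ∃ x, p ^ n ≤ (s.filter fun i => a i = x).card := by
  have : Fact p.Prime := ⟨hp⟩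
  have hchar : CharP F p := charP_of_card_eq_prime_pow hcard
  have hq1 : 1 < p ^ n := hcard ▸ Fintype.one_lt_card
  have hk0 : k + 1 < p ^ n := by
    have h3 := two_mul_lt_of_lacunary_bound hp hn3 hk
    have h4 : 2 ^ 3 ≤ p ^ 3 := Nat.pow_le_pow_left hp.two_le 3
    have h5 : p ^ 3 ≤ p ^ n := Nat.pow_le_pow_right hp.pos hn3
    omega
  have hqs : p ^ n ≤ s.card := by
    rw [← hcard, ← Finset.card_univ]
    refine Finset.card_le_card_of_surjOn b fun c _ => ?_
    obtain ⟨i, hi, h⟩ := hblock 0 c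
    exact ⟨i, hi, by simpa using h⟩
  obtain ⟨k', hk'⟩ := Nat.exists_eq_add_of_le hqs
  have hk'k : k' ≤ k := by omega
  set f : F[X] := ∏ i ∈ s, (X + C (-a i)) with hf
  have hf' : f = ((s.val.map a).map fun x => X - C x).prod := by
    rw [hf, Finset.prod, Multiset.map_map]
    simp [sub_eq_add_neg]
  have hfmonic : f.Monic := monic_prod_of_monic _ _ fun i _ => monic_X_add_C _
  have hfroots : f.roots = s.val.map a := by rw [hf', roots_multiset_prod_X_sub_C]
  have hfdeg : f.natDegree = p ^ n + k' := by
    rw [hf, natDegree_prod_of_monic _ _ fun i _ => monic_X_add_C _]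
    simpa only [natDegree_X_add_C, Finset.sum_const, smul_eq_mul, mul_one] using hk'
  have hfsplits : f.Splits := by
    rw [splits_iff_card_roots, hfroots, hfdeg]
    simpa using hk'
  have hcoeff : ∀ t, k' < t → t < p ^ n → f.coeff t = 0 := by
    intro t h1 h2
    rw [← hcard] at h2 hk'
    refine coeff_prod_X_add_C_eq_zero_of_blocking (b := b) hk' (fun m c => ?_) h1 h2
    obtain ⟨i, hi, h⟩ := hblock (-m) c
    exact ⟨i, hi, by rw [h]; ring⟩
  set g := f /ₘ X ^ p ^ n
  set h := f %ₘ X ^ p ^ n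
  have hfgh : f = X ^ p ^ n * g + h := by
    rw [add_comm]
    exact (modByMonic_add_div f (X ^ p ^ n)).symm
  have hgdeg : g.natDegree = k' := by
    rw [natDegree_divByMonic _ (monic_X_pow _), hfdeg, natDegree_X_pow]
    omega
  have hhdeg : h.natDegree ≤ k' := by
    have h1 : h.natDegree < p ^ n := by
      have := natDegree_modByMonic_lt f (monic_X_pow (R := F) (p ^ n)) (fun h1 => by
        have := congrArg natDegree h1
        rw [natDegree_X_pow, natDegree_one] at this
        omega)
      rwa [natDegree_X_pow] at this
    refine natDegree_le_iff_coeff_eq_zero.2 fun t ht => ?_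
    by_cases htq : t < p ^ n
    · have h2 := hcoeff t ht htq
      rwa [hfgh, coeff_add, coeff_X_pow_mul', if_neg (by omega), zero_add] at h2
    · exact coeff_eq_zero_of_natDegree_lt (by omega)
  have hg0 : g ≠ 0 := by
    intro h0
    rw [hfgh, h0, mul_zero, zero_add] at hfdeg
    omega
  let _ := EuclideanDomain.gcdMonoid F[X]
  obtain ⟨g₁, h₁, hg₁, hh₁, hu⟩ := extract_gcd g h
  have hcop : IsCoprime g₁ h₁ := (gcd_isUnit_iff _ _).1 hu
  set d := gcd g h
  have hd0 : d ≠ 0 := by intro h0; rw [h0, zero_mul] at hg₁; exact hg0 hg₁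
  have hg₁0 : g₁ ≠ 0 := by intro h0; rw [h0, mul_zero] at hg₁; exact hg0 hg₁
  have hfd : f = d * (X ^ p ^ n * g₁ + h₁) := by
    rw [hfgh]
    linear_combination X ^ p ^ n * hg₁ + hh₁
  have hg₁deg : g₁.natDegree ≤ k' := by
    rw [← hgdeg, hg₁, natDegree_mul hd0 hg₁0]
    omega
  have hh₁deg : h₁.natDegree ≤ k' := by
    by_cases h0 : h₁ = 0
    · simp [h0]
    · rw [hh₁, natDegree_mul hd0 h0] at hhdeg
      omega
  have hdvd : X ^ p ^ n * g₁ + h₁ ∣ f := ⟨d, by rw [hfd, mul_comm]⟩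
  rcases lacunary_dichotomy hcard hn hn3 hcop hg₁0 (hg₁deg.trans hk'k) (hh₁deg.trans hk'k) hk
      (hfsplits.of_dvd hfmonic.ne_zero hdvd) with h0 | ⟨α, β, hα, h1⟩
  · exfalso
    have hlt := two_mul_card_sub_one_lt_of_blocking hblock fun x => by
      have h2 : f.IsRoot x := by
        have h3 := congrArg (eval x) h0
        have h4 : x ^ p ^ n = x := hcard ▸ FiniteField.pow_card x
        simp only [eval_add, eval_mul, eval_X, eval_zero] at h3
        rw [IsRoot, hfd, eval_mul, eval_add, eval_mul, eval_pow, eval_X, h4, h3, mul_zero]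
      have h3 := (mem_roots hfmonic.ne_zero).2 h2
      rw [hfroots] at h3
      simpa using h3
    omega
  · refine ⟨-β / α, ?_⟩
    have h2 : (X - C (-β / α)) ^ p ^ n ∣ f := by
      refine dvd_trans ?_ hdvd
      rw [h1]
      refine pow_dvd_pow_of_dvd ⟨C α, ?_⟩ _
      rw [sub_mul, ← C_mul, div_mul_cancel₀ _ hα, C_neg]
      ring
    rw [← le_rootMultiplicity_iff hfmonic.ne_zero, ← count_roots, hfroots, Multiset.count_map] at h2
    convert h2 using 2
    simp [Finset.card, eq_comm]

end

theorem card_filter_le_ker_mul {F V : Type*} [Field F] [Fintype F] [AddCommGroup V] [Module F V]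
    [Finite V] [Fintype (Module.Dual F V)] (W : Submodule F V)
    [DecidablePred fun φ : Module.Dual F V => W ≤ φ.ker] :
    (Finset.univ.filter fun φ : Module.Dual F V => W ≤ φ.ker).card *
      Fintype.card F ^ Module.finrank F W = Fintype.card F ^ Module.finrank F V := by
  classical
  have h1 : (Finset.univ.filter fun φ : Module.Dual F V => W ≤ φ.ker).card =
      Fintype.card W.dualAnnihilator := by
    rw [Fintype.card_of_subtype]
    intro φ
    simp [Submodule.mem_dualAnnihilator, SetLike.le_def]
  rw [h1, Module.card_eq_pow_finrank (K := F), ← pow_add, add_comm,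
    Subspace.finrank_add_finrank_dualAnnihilator_eq]

/-- If every functional is constant on most of a family of vectors, then most members of the
family coincide. -/
theorem exists_card_le_fiber_of_forall_dual {F U ι : Type*} [Field F] [Fintype F]
    [AddCommGroup U] [Module F U] [Finite U] [DecidableEq F] [DecidableEq U] {s : Finset ι}
    {y : ι → U} (hs : 2 * s.card < 3 * Fintype.card F)
    (hy : ∀ φ : Module.Dual F U,
      ∃ a, Fintype.card F ≤ (s.filter fun i => φ (y i) = a).card) :
    ∃ z, Fintype.card F ≤ (s.filter fun i => y i = z).card := by
  classical
  have : Finite (Module.Dual F U) := Module.finite_of_finite F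
  have := Fintype.ofFinite (Module.Dual F U)
  set q := Fintype.card F
  have hq1 : 1 < q := Fintype.one_lt_card
  choose α hα using hy
  have hmeet : ∀ φ₁ φ₂ φ₃ : Module.Dual F U,
      ∃ i, φ₁ (y i) = α φ₁ ∧ φ₂ (y i) = α φ₂ ∧ φ₃ (y i) = α φ₃ := by
    intro φ₁ φ₂ φ₃
    by_contra! h
    have hcover : s ⊆ s.filter (fun i => φ₁ (y i) ≠ α φ₁) ∪
        (s.filter (fun i => φ₂ (y i) ≠ α φ₂) ∪ s.filter fun i => φ₃ (y i) ≠ α φ₃) := by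
      intro i hi
      have := h i
      simp only [Finset.mem_union, Finset.mem_filter]
      tauto
    have h1 := Finset.card_le_card hcover
    have h2 := Finset.card_union_le (s.filter fun i => φ₁ (y i) ≠ α φ₁)
      (s.filter (fun i => φ₂ (y i) ≠ α φ₂) ∪ s.filter fun i => φ₃ (y i) ≠ α φ₃)
    have h3 := Finset.card_union_le (s.filter fun i => φ₂ (y i) ≠ α φ₂)
      (s.filter fun i => φ₃ (y i) ≠ α φ₃)
    have h4 := fun φ : Module.Dual F U =>
      Finset.card_filter_add_card_filter_not (s := s) (fun i => φ (y i) = α φ)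
    have h5 := h4 φ₁
    have h6 := h4 φ₂
    have h7 := h4 φ₃
    have h8 := hα φ₁
    have h9 := hα φ₂
    have h10 := hα φ₃
    simp only [ne_eq] at *
    omega
  let A : Module.Dual F (Module.Dual F U) :=
    { toFun := α
      map_add' := fun φ φ' => by
        obtain ⟨i, h1, h2, h3⟩ := hmeet φ φ' (φ + φ')
        rw [← h1, ← h2, ← h3, LinearMap.add_apply]
      map_smul' := fun c φ => by
        obtain ⟨i, h1, h2, -⟩ := hmeet φ (c • φ) φ
        rw [← h1, ← h2, LinearMap.smul_apply, RingHom.id_apply] }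
  obtain ⟨z, hz⟩ := (Module.evalEquiv F U).surjective A
  have hαz : ∀ φ, α φ = φ z := fun φ => by
    rw [← Module.Dual.eval_apply, ← Module.evalEquiv_apply, hz]
    rfl
  refine ⟨z, ?_⟩
  by_contra! hlt
  set Q := Fintype.card (Module.Dual F U) with hQ
  have hQpos : 0 < Q := Fintype.card_pos
  have hker : ∀ i, q * (Finset.univ.filter fun φ : Module.Dual F U => φ (y i) = φ z).card =
      if y i = z then q * Q else Q := by
    intro i
    split_ifs with h
    · simp [h, hQ]
    · have h1 := card_filter_le_ker_mul (F := F) (Submodule.span F {y i - z})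
      rw [finrank_span_singleton (sub_ne_zero.2 h), pow_one, mul_comm] at h1
      rw [hQ, Module.card_eq_pow_finrank (K := F), Subspace.dual_finrank_eq, ← h1]
      congr 2
      ext φ
      simp [Submodule.span_singleton_le_iff_mem, sub_eq_zero]
  have hsum : Q * q ≤
      ∑ i ∈ s, (Finset.univ.filter fun φ : Module.Dual F U => φ (y i) = φ z).card := by
    have h1 := Finset.sum_card_bipartiteAbove_eq_sum_card_bipartiteBelow (s := s)
      (t := Finset.univ) fun i (φ : Module.Dual F U) => φ (y i) = φ z
    refine le_trans ?_ h1.ge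
    rw [hQ, ← Finset.card_univ, ← smul_eq_mul, ← Finset.sum_const]
    refine Finset.sum_le_sum fun φ _ => ?_
    have h2 := hα φ
    rw [hαz] at h2
    exact h2
  have hsum' := Nat.mul_le_mul_left q hsum
  rw [Finset.mul_sum, Finset.sum_congr rfl fun i _ => hker i, Finset.sum_ite, Finset.sum_const,
    Finset.sum_const, smul_eq_mul, smul_eq_mul] at hsum'
  have hpart := Finset.card_filter_add_card_filter_not (s := s) (fun i => y i = z)
  set m := (s.filter fun i => y i = z).card
  set m' := (s.filter fun i => ¬ y i = z).card
  have h1 : q * q ≤ m * q + m' := by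
    refine Nat.le_of_mul_le_mul_left ?_ hQpos
    nlinarith
  obtain ⟨r, hr⟩ : ∃ r, q = m + 1 + r := ⟨q - m - 1, by omega⟩
  nlinarith

/-- A small set of nonzero vectors, closed under scaling and meeting every hyperplane, contains all
nonzero vectors of some two-dimensional subspace. -/
theorem exists_plane_subset_of_blocking {F V : Type*} [Field F] [Fintype F] [AddCommGroup V]
    [Module F V] [Finite V] [Nontrivial V] {p n k : ℕ} (hp : p.Prime)
    (hcard : Fintype.card F = p ^ n) (hn : Odd n) (hn3 : 3 ≤ n)
    (hk : (if p ≤ 3 then 2 else 1) * k ^ 3 < (p ^ n) ^ 2) {H : Finset V} (hH0 : 0 ∉ H)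
    (hsmul : ∀ (c : F) (v : V), c ≠ 0 → v ∈ H → c • v ∈ H)
    (hHcard : H.card ≤ (p ^ n - 1) * (p ^ n + k + 1))
    (hblock : ∀ g : Module.Dual F V, g ≠ 0 → ∃ v ∈ H, g v = 0) :
    ∃ W : Submodule F V, Module.finrank F W = 2 ∧ ∀ v ∈ W, v ≠ 0 → v ∈ H := by
  classical
  have hkq := two_mul_lt_of_lacunary_bound hp hn3 hk
  have hq1 : 1 < Fintype.card F := Fintype.one_lt_card
  obtain ⟨B, hBH, hB, hBmin⟩ := exists_minimal_le_of_wellFoundedLT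
    (fun B : Finset V => ∀ g : Module.Dual F V, g ≠ 0 → ∃ v ∈ B, g v = 0) H hblock
  have hB0 : ∀ v ∈ B, v ≠ 0 := fun v hv h0 => hH0 (h0 ▸ hBH hv)
  have herase : ∀ v ∈ B, ∃ g : Module.Dual F V, g ≠ 0 ∧ g v = 0 ∧ ∀ w ∈ B.erase v, g w ≠ 0 := by
    intro v hv
    have h1 : ¬ ∀ g : Module.Dual F V, g ≠ 0 → ∃ w ∈ B.erase v, g w = 0 := fun h =>
      Finset.notMem_erase v B (hBmin h (Finset.erase_subset v B) hv)
    push Not at h1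
    obtain ⟨g, hg, h2⟩ := h1
    obtain ⟨w, hw, hgw⟩ := hB g hg
    have hwv : w = v := by
      by_contra hne
      exact h2 w (Finset.mem_erase.2 ⟨hne, hw⟩) hgw
    exact ⟨g, hg, hwv ▸ hgw, h2⟩
  have hprop : ∀ v ∈ B, ∀ w ∈ B, ∀ c : F, w = c • v → w = v := by
    intro v hv w hw c hc
    by_contra hne
    obtain ⟨g, -, h1, h2⟩ := herase v hv
    exact h2 w (Finset.mem_erase.2 ⟨hne, hw⟩) (by rw [hc, map_smul, h1, smul_zero])
  have hBcard : B.card ≤ p ^ n + k + 1 := by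
    have h1 : Fintype.card Fˣ * B.card ≤ H.card := by
      rw [← Finset.card_univ, ← Finset.card_product]
      refine Finset.card_le_card_of_injOn (fun x => (x.1 : F) • x.2) ?_ ?_
      · intro x hx
        exact hsmul _ _ x.1.ne_zero (hBH (Finset.mem_product.1 hx).2)
      · rintro ⟨c, v⟩ hx ⟨d, w⟩ hy hxy
        have hv : v ∈ B := (Finset.mem_product.1 hx).2
        have hw : w ∈ B := (Finset.mem_product.1 hy).2
        dsimp only at hxy
        obtain rfl : w = v := hprop v hv w hw ((d : F)⁻¹ * c) (by
          rw [mul_smul, hxy, inv_smul_smul₀ d.ne_zero])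
        rw [Prod.mk.injEq]
        exact ⟨Units.ext (smul_left_injective F (hB0 w hw) hxy), rfl⟩
    rw [Fintype.card_units, hcard] at h1
    exact Nat.le_of_mul_le_mul_left (h1.trans hHcard) (by omega)
  obtain ⟨x, hx⟩ := exists_ne (0 : V)
  obtain ⟨g, hg⟩ := Module.Projective.exists_dual_eq_one F hx
  obtain ⟨v₀, hv₀, -⟩ := hB g (by rintro rfl; simp at hg)
  obtain ⟨w, -, hwv₀, hw⟩ := herase v₀ hv₀
  obtain ⟨ψ, hψ⟩ := Module.Projective.exists_dual_eq_one F (hB0 v₀ hv₀)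
  set s := B.erase v₀
  have hs : s.card ≤ p ^ n + k := by
    have : s.card + 1 = B.card := Finset.card_erase_add_one hv₀
    omega
  let ν : V → V := fun v => (w v)⁻¹ • v
  have hνw : ∀ v ∈ s, w (ν v) = 1 := fun v hv => by
    simp [ν, hw v hv]
  have hνinj : Set.InjOn ν s := by
    intro v hv v' hv' h
    refine hprop v' (Finset.mem_of_mem_erase hv') v (Finset.mem_of_mem_erase hv)
      (w v * (w v')⁻¹) ?_
    rw [mul_smul]
    change v = w v • ν v'
    rw [← h, smul_inv_smul₀ (hw v hv)]
  have : Finite (V ⧸ Submodule.span F {v₀}) := Quotient.finite _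
  obtain ⟨z, hz⟩ : ∃ z, Fintype.card F ≤
      (s.filter fun v => (Submodule.span F {v₀}).mkQ (ν v) = z).card := by
    refine exists_card_le_fiber_of_forall_dual (by rw [hcard]; omega) fun φ => ?_
    rw [hcard]
    refine exists_card_le_fiber_of_blocking hp hcard hn hn3 hk (b := fun v => ψ (ν v)) hs
      fun m c => ?_
    let φ' := φ ∘ₗ (Submodule.span F {v₀}).mkQ
    have hφ' : φ' v₀ = 0 := by
      have h1 : (Submodule.span F {v₀}).mkQ v₀ = 0 := by
        simp [Submodule.mem_span_singleton_self]
      rw [LinearMap.comp_apply, h1, map_zero]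
    have h1 : (ψ - m • φ' - c • w) v₀ = 1 := by simp [hψ, hφ', hwv₀]
    obtain ⟨v, hv, h2⟩ := hB (ψ - m • φ' - c • w) (by intro h0; simp [h0] at h1)
    have hvs : v ∈ s := by
      refine Finset.mem_erase.2 ⟨?_, hv⟩
      rintro rfl
      exact one_ne_zero (h1.symm.trans h2)
    refine ⟨v, hvs, ?_⟩
    have h3 : (ψ - m • φ' - c • w) (ν v) = 0 := by rw [map_smul, h2, smul_zero]
    have h4 := hνw v hvs
    simp only [LinearMap.sub_apply, LinearMap.smul_apply, smul_eq_mul, h4] at h3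
    change ψ (ν v) = m * φ' (ν v) + c
    linear_combination h3
  obtain ⟨v₁, hv₁⟩ := Finset.card_pos.1 (lt_of_lt_of_le (by omega) hz)
  obtain ⟨hv₁s, hv₁z⟩ := Finset.mem_filter.1 hv₁
  have hwZ := hνw v₁ hv₁s
  generalize hZ : ν v₁ = Z at hv₁z hwZ
  have himage : (s.filter fun v => (Submodule.span F {v₀}).mkQ (ν v) = z).image ν =
      Finset.univ.image fun t : F => Z + t • v₀ := by
    refine Finset.eq_of_subset_of_card_le ?_ ?_
    · intro x hx
      obtain ⟨v, hv, rfl⟩ := Finset.mem_image.1 hx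
      have h1 := (Finset.mem_filter.1 hv).2
      rw [← hv₁z, Submodule.mkQ_apply, Submodule.mkQ_apply, Submodule.Quotient.eq,
        Submodule.mem_span_singleton] at h1
      obtain ⟨t, ht⟩ := h1
      exact Finset.mem_image.2 ⟨t, Finset.mem_univ t, by rw [ht]; abel⟩
    · rw [Finset.card_image_of_injOn (hνinj.mono fun v hv => (Finset.mem_filter.1 hv).1)]
      exact Finset.card_image_le.trans hz
  have hline : ∀ t : F, Z + t • v₀ ∈ H := by
    intro t
    have h1 : Z + t • v₀ ∈ Finset.univ.image fun t : F => Z + t • v₀ :=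
      Finset.mem_image_of_mem _ (Finset.mem_univ t)
    rw [← himage] at h1
    obtain ⟨v, hv, h2⟩ := Finset.mem_image.1 h1
    rw [← h2]
    have hvs := (Finset.mem_filter.1 hv).1
    exact hsmul _ _ (inv_ne_zero (hw v hvs)) (hBH (Finset.mem_of_mem_erase hvs))
  refine ⟨Submodule.span F {Z, v₀}, ?_, ?_⟩
  · have hli : LinearIndependent F ![Z, v₀] := by
      rw [LinearIndependent.pair_iff]
      intro a b hab
      have h1 := congrArg w hab
      rw [map_add, map_smul, map_smul, hwZ, hwv₀] at h1
      obtain rfl : a = 0 := by simpa using h1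
      simpa [hB0 v₀ hv₀] using hab
    have h1 := finrank_span_eq_card hli
    rwa [Matrix.range_cons, Matrix.range_cons, Matrix.range_empty, Set.union_empty,
      Set.singleton_union, Fintype.card_fin] at h1
  · intro v hv hv0
    obtain ⟨a, b, rfl⟩ := Submodule.mem_span_pair.1 hv
    by_cases ha : a = 0
    · subst ha
      have hb : b ≠ 0 := by rintro rfl; simp at hv0
      rw [zero_smul, zero_add]
      exact hsmul b v₀ hb (hBH hv₀)
    · have h1 := hsmul a _ ha (hline (b / a))
      rwa [smul_add, smul_smul, mul_div_cancel₀ _ ha] at h1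

theorem card_filter_ne_zero_and_mem {F V : Type*} [Field F] [Fintype F] [AddCommGroup V]
    [Module F V] [Fintype V] [DecidableEq V] (W : Submodule F V) [DecidablePred (· ∈ W)] :
    ((Finset.univ.filter fun v : V => v ≠ 0 ∧ v ∈ W).card : ℤ) =
      (Fintype.card F : ℤ) ^ Module.finrank F W - 1 := by
  have h1 : (Finset.univ.filter fun v : V => v ∈ W).card =
      Fintype.card F ^ Module.finrank F W := by
    rw [← Module.card_eq_pow_finrank, Fintype.card_subtype]
  have h2 : (Finset.univ.filter fun v : V => v ≠ 0 ∧ v ∈ W) =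
      (Finset.univ.filter fun v : V => v ∈ W).erase 0 := by
    ext v
    simp
  rw [h2, Finset.card_erase_of_mem (by simp), h1, Nat.cast_sub, Nat.cast_pow, Nat.cast_one]
  exact Nat.one_le_pow _ _ Fintype.card_pos

/-- Counting the nonzero vectors of a subspace `W` along a family `S` of independent subspaces. -/
theorem card_filter_mem_add_sum {F V : Type*} [Field F] [Fintype F] [AddCommGroup V] [Module F V]
    [Finite V] {S : Finset (Submodule F V)}
    (hS : ∀ l ∈ S, ∀ l' ∈ S, l ≠ l' → l ⊓ l' = ⊥) {H : Finset V}
    (hH : ∀ v, v ∈ H ↔ v ≠ 0 ∧ ∀ l ∈ S, v ∉ l) (W : Submodule F V) [DecidablePred (· ∈ W)] :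
    ((H.filter fun v => v ∈ W).card : ℤ) +
        ∑ l ∈ S, ((Fintype.card F : ℤ) ^ Module.finrank F ↥(l ⊓ W) - 1) =
      (Fintype.card F : ℤ) ^ Module.finrank F W - 1 := by
  classical
  have := Fintype.ofFinite V
  have hdecomp : (Finset.univ.filter fun v : V => v ≠ 0 ∧ v ∈ W) =
      (H.filter fun v => v ∈ W) ∪
        S.biUnion fun l => Finset.univ.filter fun v : V => v ≠ 0 ∧ v ∈ l ⊓ W := by
    ext v
    simp only [Finset.mem_union, Finset.mem_biUnion, Finset.mem_filter, Finset.mem_univ, true_and,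
      hH, Submodule.mem_inf]
    by_cases h : ∃ l ∈ S, v ∈ l
    · obtain ⟨l, hl, hv⟩ := h
      exact ⟨fun h1 => Or.inr ⟨l, hl, h1.1, hv, h1.2⟩, by tauto⟩
    · push Not at h
      exact ⟨fun h1 => Or.inl ⟨⟨h1.1, h⟩, h1.2⟩, by tauto⟩
  rw [← card_filter_ne_zero_and_mem W, hdecomp, Finset.card_union_of_disjoint, Finset.card_biUnion,
    Nat.cast_add, Nat.cast_sum]
  · simp only [card_filter_ne_zero_and_mem]
  · intro l hl l' hl' hne
    refine Finset.disjoint_left.2 fun v hv hv' => ?_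
    have h1 := (Finset.mem_filter.1 hv).2
    have h2 := (Finset.mem_filter.1 hv').2
    have h3 : v ∈ l ⊓ l' := ⟨h1.2.1, h2.2.1⟩
    rw [hS l hl l' hl' hne] at h3
    exact h1.1 ((Submodule.mem_bot F).1 h3)
  · refine Finset.disjoint_left.2 fun v hv hv' => ?_
    obtain ⟨l, hl, h1⟩ := Finset.mem_biUnion.1 hv'
    exact ((hH v).1 (Finset.mem_filter.1 hv).1).2 l hl (Finset.mem_filter.1 h1).2.2.1

theorem finrank_inf_ker_add_one {F V : Type*} [Field F] [AddCommGroup V] [Module F V]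
    [FiniteDimensional F V] {l : Submodule F V} {f : Module.Dual F V} (hl : ¬ l ≤ f.ker) :
    Module.finrank F ↥(l ⊓ f.ker) + 1 = Module.finrank F l := by
  have hf : f ≠ 0 := by rintro rfl; simp at hl
  have h1 : l ⊔ f.ker = ⊤ := by
    refine (LinearMap.isCoatom_ker_of_surjective (LinearMap.surjective hf)).2 _ ?_
    exact lt_of_le_of_ne le_sup_right fun h => hl (h ▸ le_sup_left)
  have h2 := Submodule.finrank_sup_add_finrank_inf_eq l f.ker
  have h3 := Module.Dual.finrank_ker_add_one_of_ne_zero hf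
  rw [h1, finrank_top] at h2
  omega

theorem sum_card_filter_pencil {F V : Type*} [Field F] [Fintype F] [DecidableEq F]
    [AddCommGroup V] [Module F V] (f g : Module.Dual F V) (H : Finset V) :
    ∑ c : F, (H.filter fun v => (g + c • f) v = 0).card + (H.filter fun v => f v = 0).card =
      H.card + Fintype.card F * (H.filter fun v => f v = 0 ∧ g v = 0).card := by
  simp only [Finset.card_filter]
  rw [Finset.sum_comm, ← Finset.sum_add_distrib, Finset.mul_sum, Finset.card_eq_sum_ones,
    ← Finset.sum_add_distrib]
  refine Finset.sum_congr rfl fun v _ => ?_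
  rw [← Finset.card_filter]
  by_cases hf : f v = 0
  · by_cases hg : g v = 0 <;> simp [hf, hg, add_comm]
  · have h1 : (Finset.univ.filter fun c : F => (g + c • f) v = 0) = {-(g v) / f v} := by
      ext c
      simp only [Finset.mem_filter, Finset.mem_univ, true_and, Finset.mem_singleton,
        LinearMap.add_apply, LinearMap.smul_apply, smul_eq_mul, eq_div_iff hf]
      exact ⟨fun h => by linear_combination h, fun h => by linear_combination h⟩
    rw [h1]
    simp [hf]

theorem sum_card_filter_le_ker {F V : Type*} [Field F] [AddCommGroup V] [Module F V]
    [Fintype (Module.Dual F V)] [∀ (l : Submodule F V) (f : Module.Dual F V), Decidable (l ≤ f.ker)]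
    (S : Finset (Submodule F V)) :
    ∑ f : Module.Dual F V, (S.filter fun l => l ≤ f.ker).card =
      ∑ l ∈ S, (Finset.univ.filter fun f : Module.Dual F V => l ≤ f.ker).card :=
  (Finset.sum_card_bipartiteAbove_eq_sum_card_bipartiteBelow
    fun (l : Submodule F V) (f : Module.Dual F V) => l ≤ f.ker).symm

theorem sum_card_filter_le_ker_sq {F V : Type*} [Field F] [AddCommGroup V] [Module F V]
    [Fintype (Module.Dual F V)] [∀ (l : Submodule F V) (f : Module.Dual F V), Decidable (l ≤ f.ker)]
    (S : Finset (Submodule F V)) :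
    ∑ f : Module.Dual F V, (S.filter fun l => l ≤ f.ker).card ^ 2 =
      ∑ l ∈ S, ∑ l' ∈ S,
        (Finset.univ.filter fun f : Module.Dual F V => l ⊔ l' ≤ f.ker).card := by
  simp only [sq, Finset.card_filter, Finset.sum_mul_sum]
  rw [Finset.sum_comm]
  refine Finset.sum_congr rfl fun l _ => ?_
  rw [Finset.sum_comm]
  refine Finset.sum_congr rfl fun l' _ => Finset.sum_congr rfl fun f _ => ?_
  by_cases h : l ≤ f.ker <;> by_cases h' : l' ≤ f.ker <;> simp [h, h']

/-- A second moment argument over all hyperplanes. -/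
theorem exists_sub_card_filter_le_ker_eq_one {F V : Type*} [Field F] [Fintype F]
    [AddCommGroup V] [Module F V] [Finite V] {q k e : ℕ} {t : ℤ} (hcard : Fintype.card F = q)
    (hV : Module.finrank F V = 2 * e + 4) (ht : (q : ℤ) ^ (2 * e) = ((q : ℤ) ^ 2 - 1) * t + 1)
    (ht0 : 0 ≤ t) {S : Finset (Submodule F V)} (hdim : ∀ l ∈ S, Module.finrank F l = 2)
    (hS : ∀ l ∈ S, ∀ l' ∈ S, l ≠ l' → l ⊓ l' = ⊥) (hkq : k < q)
    (hScard : (S.card : ℤ) + (k + 1) = (q : ℤ) ^ 2 * ((q : ℤ) ^ 2 * t + 1) + 1)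
    [∀ (l : Submodule F V) (f : Module.Dual F V), Decidable (l ≤ f.ker)]
    (hx : ∀ f : Module.Dual F V, f ≠ 0 →
      ((S.filter fun l => l ≤ f.ker).card : ℤ) ≤ (q : ℤ) ^ 2 * t + 1) :
    ∃ f : Module.Dual F V, f ≠ 0 ∧
      (q : ℤ) ^ 2 * t + 1 - (S.filter fun l => l ≤ f.ker).card = 1 := by
  classical
  have : Finite (Module.Dual F V) := Module.finite_of_finite F
  have := Fintype.ofFinite (Module.Dual F V)
  have hq1 : 1 < q := hcard ▸ Fintype.one_lt_card
  set T : ℤ := (q : ℤ) ^ 2 * t + 1 with hT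
  let x : Module.Dual F V → ℕ := fun f => (S.filter fun l => l ≤ f.ker).card
  have hker : ∀ W : Submodule F V, ∀ d, Module.finrank F W + d = 2 * e + 4 →
      (Finset.univ.filter fun f : Module.Dual F V => W ≤ f.ker).card = q ^ d := by
    intro W d hd
    have h1 := card_filter_le_ker_mul (F := F) W
    rw [hV, ← hd, add_comm, pow_add, hcard] at h1
    exact Nat.eq_of_mul_eq_mul_right (pow_pos (by omega) _) h1
  have hsum : ∑ f : Module.Dual F V, (x f : ℤ) = S.card * (q : ℤ) ^ (2 * e + 2) := by
    rw [← Nat.cast_sum, sum_card_filter_le_ker, Finset.sum_congr rfl fun l hl =>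
      hker l (2 * e + 2) (by rw [hdim l hl]; ring)]
    simp
  have hsumsq : ∑ f : Module.Dual F V, (x f : ℤ) ^ 2 =
      S.card * ((q : ℤ) ^ (2 * e + 2) + (S.card - 1) * (q : ℤ) ^ (2 * e)) := by
    have h1 : ∀ l ∈ S, ∀ l' ∈ S,
        ((Finset.univ.filter fun f : Module.Dual F V => l ⊔ l' ≤ f.ker).card : ℤ) =
          (q : ℤ) ^ (2 * e) + if l = l' then (q : ℤ) ^ (2 * e + 2) - (q : ℤ) ^ (2 * e) else 0 := by
      intro l hl l' hl'
      split_ifs with h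
      · subst h
        rw [hker _ (2 * e + 2) (by rw [sup_idem, hdim l hl]; ring)]
        push_cast
        ring
      · have h2 := Submodule.finrank_sup_add_finrank_inf_eq l l'
        rw [hS l hl l' hl' h, finrank_bot, hdim l hl, hdim l' hl'] at h2
        rw [hker _ (2 * e) (by omega)]
        simp
    have h2 := congrArg (Nat.cast (R := ℤ)) (sum_card_filter_le_ker_sq S)
    push_cast at h2
    refine h2.trans ?_
    rw [Finset.sum_congr rfl fun l hl => (Finset.sum_congr rfl (h1 l hl)).trans
      (Finset.sum_add_distrib.trans (by rw [Finset.sum_ite_eq, if_pos hl, Finset.sum_const]))]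
    rw [Finset.sum_const]
    simp only [nsmul_eq_mul]
    ring
  by_contra! hne
  have hnonneg : ∀ f ∈ Finset.univ.erase (0 : Module.Dual F V),
      0 ≤ (T - x f) * (T - x f - 2) := by
    intro f hf
    have h1 : (x f : ℤ) ≤ T := hx f (Finset.ne_of_mem_erase hf)
    have h2 : T - x f ≠ 1 := hne f (Finset.ne_of_mem_erase hf)
    rcases (show T - x f = 0 ∨ 2 ≤ T - x f by omega) with h3 | h3
    · simp [h3]
    · exact mul_nonneg (by omega) (by omega)
  have hpos := Finset.sum_nonneg hnonneg
  have hx0 : x 0 = S.card := by simp [x]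
  have hcardDual : (Fintype.card (Module.Dual F V) : ℤ) = (q : ℤ) ^ (2 * e + 4) := by
    rw [Module.card_eq_pow_finrank (K := F), Subspace.dual_finrank_eq, hV, hcard]
    push_cast
    rfl
  have hall : ∑ f : Module.Dual F V, (T - x f) * (T - x f - 2) =
      (q : ℤ) ^ (2 * e + 4) * (T * (T - 2)) - (2 * T - 2) * ∑ f : Module.Dual F V, (x f : ℤ) +
        ∑ f : Module.Dual F V, (x f : ℤ) ^ 2 := by
    rw [Finset.mul_sum, ← hcardDual, ← Finset.card_univ, ← nsmul_eq_mul, ← Finset.sum_const,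
      ← Finset.sum_sub_distrib, ← Finset.sum_add_distrib]
    exact Finset.sum_congr rfl fun f _ => by ring
  rw [← Finset.add_sum_erase _ _ (Finset.mem_univ 0), hx0, hsum, hsumsq, pow_add, pow_add, ht,
    show (S.card : ℤ) = q ^ 2 * T + 1 - (k + 1) by linarith] at hall
  have h1 : 0 ≤ (((q : ℤ) ^ 2 - 1) * (k + 1)) * (k * t - T) := by
    refine hpos.trans_eq ?_
    linear_combination hall
  have hqsq : (q : ℤ) < (q : ℤ) ^ 2 := by exact_mod_cast lt_self_pow₀ hq1 one_lt_two
  have h2 : (k : ℤ) * t < T := by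
    have : (k : ℤ) * t ≤ (q : ℤ) ^ 2 * t := mul_le_mul_of_nonneg_right (by omega) ht0
    omega
  have h3 : (0 : ℤ) < ((q : ℤ) ^ 2 - 1) * (k + 1) := mul_pos (by omega) (by omega)
  exact absurd h1 (not_le.2 (mul_neg_of_pos_of_neg h3 (by omega)))

/-- A partial spread of lines whose deficiency is small and positive can be enlarged. -/
theorem exists_plane_disjoint_of_small_deficiency {F V : Type*} [Field F] [Fintype F]
    [AddCommGroup V] [Module F V] [Finite V] {p n k e : ℕ} {t : ℤ} (hp : p.Prime)
    (hcard : Fintype.card F = p ^ n) (hn : Odd n) (hn3 : 3 ≤ n)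
    (hk : (if p ≤ 3 then 2 else 1) * k ^ 3 < (p ^ n) ^ 2) (hV : Module.finrank F V = 2 * e + 4)
    (ht : ((p ^ n : ℕ) : ℤ) ^ (2 * e) = (((p ^ n : ℕ) : ℤ) ^ 2 - 1) * t + 1)
    {S : Finset (Submodule F V)} (hdim : ∀ l ∈ S, Module.finrank F l = 2)
    (hS : ∀ l ∈ S, ∀ l' ∈ S, l ≠ l' → l ⊓ l' = ⊥)
    (hScard : (S.card : ℤ) + (k + 1) =
      ((p ^ n : ℕ) : ℤ) ^ 2 * (((p ^ n : ℕ) : ℤ) ^ 2 * t + 1) + 1) :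
    ∃ W : Submodule F V, Module.finrank F W = 2 ∧ ∀ l ∈ S, W ⊓ l = ⊥ := by
  classical
  have := Fintype.ofFinite V
  have : Finite (Module.Dual F V) := Module.finite_of_finite F
  have := Fintype.ofFinite (Module.Dual F V)
  have hkq := two_mul_lt_of_lacunary_bound hp hn3 hk
  have h8 : 8 ≤ p ^ n :=
    (Nat.pow_le_pow_left hp.two_le 3).trans (Nat.pow_le_pow_right hp.pos hn3)
  set q := p ^ n with hq
  have hkq' : k < q := by omega
  zify at hkq h8
  have ht0 : 0 ≤ t := by
    by_contra! h
    have h1 : (0 : ℤ) < (q : ℤ) ^ (2 * e) := by positivity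
    have h2 : (1 : ℤ) < (q : ℤ) ^ 2 := one_lt_pow₀ (by omega) two_ne_zero
    nlinarith
  set T : ℤ := (q : ℤ) ^ 2 * t + 1 with hT
  let x : Module.Dual F V → ℕ := fun f => (S.filter fun l => l ≤ f.ker).card
  let H : Finset V := Finset.univ.filter fun v => v ≠ 0 ∧ ∀ l ∈ S, v ∉ l
  have hH : ∀ v, v ∈ H ↔ v ≠ 0 ∧ ∀ l ∈ S, v ∉ l := fun v => by simp [H]
  have hHtotal : (H.card : ℤ) = (k + 1) * ((q : ℤ) ^ 2 - 1) := by
    have h1 := card_filter_mem_add_sum hS hH ⊤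
    rw [Finset.sum_congr rfl fun l hl => by rw [inf_top_eq, hdim l hl], finrank_top, hV, hcard,
      Finset.sum_const, nsmul_eq_mul, pow_add, ht, Finset.filter_true_of_mem (by simp)] at h1
    linear_combination h1 - ((q : ℤ) ^ 2 - 1) * hScard
  have hHker : ∀ f : Module.Dual F V, f ≠ 0 → ((H.filter fun v => f v = 0).card : ℤ) =
      (q - 1) * (k + 1 + q * (T - x f)) := by
    intro f hf
    have h1 := card_filter_mem_add_sum hS hH f.ker
    have h2 : ∀ l ∈ S, ((Fintype.card F : ℤ) ^ Module.finrank F ↥(l ⊓ f.ker) - 1) =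
        (q - 1) + if l ≤ f.ker then (q : ℤ) ^ 2 - q else 0 := by
      intro l hl
      rw [hcard]
      split_ifs with h
      · rw [inf_eq_left.2 h, hdim l hl]
        ring
      · have h3 := finrank_inf_ker_add_one h
        rw [hdim l hl] at h3
        rw [show Module.finrank F ↥(l ⊓ f.ker) = 1 by omega]
        ring
    have h3 := Module.Dual.finrank_ker_add_one_of_ne_zero hf
    have h4 : Module.finrank F f.ker = 2 * e + 3 := by omega
    rw [Finset.sum_congr rfl h2, Finset.sum_add_distrib, ← Finset.sum_filter, Finset.sum_const,
      Finset.sum_const, nsmul_eq_mul, nsmul_eq_mul, h4, hcard, pow_add, ht] at h1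
    simp only [LinearMap.mem_ker] at h1
    linear_combination h1 - ((q : ℤ) - 1) * hScard
  have hx : ∀ f : Module.Dual F V, f ≠ 0 → (x f : ℤ) ≤ T := by
    intro f hf
    by_contra! h
    have h1 := hHker f hf
    have h2 : (k : ℤ) + 1 + q * (T - x f) < 0 := by nlinarith
    nlinarith
  obtain ⟨f, hf, hfx⟩ := exists_sub_card_filter_le_ker_eq_one hcard hV ht ht0 hdim hS hkq'
    (by rw [hScard, hT]) hx
  replace hfx : T - x f = 1 := hfx
  have hmeet : ∀ g : Module.Dual F V, (¬ ∃ c : F, g = c • f) → ∃ v ∈ H, f v = 0 ∧ g v = 0 := by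
    intro g hg
    have h1 := congrArg (Nat.cast (R := ℤ)) (sum_card_filter_pencil f g H)
    push_cast at h1
    have h2 : ∀ c ∈ Finset.univ (α := F), ((q : ℤ) - 1) * (k + 1) ≤
        ((H.filter fun v => (g + c • f) v = 0).card : ℤ) := by
      intro c _
      have hne : g + c • f ≠ 0 := fun h0 =>
        hg ⟨-c, (eq_neg_of_add_eq_zero_left h0).trans (neg_smul c f).symm⟩
      rw [hHker _ hne]
      have := hx _ hne
      refine mul_le_mul_of_nonneg_left ?_ (by omega)
      have : 0 ≤ (q : ℤ) * (T - x (g + c • f)) := mul_nonneg (by omega) (by omega)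
      omega
    have h3 := Finset.sum_le_sum h2
    rw [Finset.sum_const, nsmul_eq_mul, Finset.card_univ] at h3
    rw [hHker f hf, hfx, hHtotal, hcard] at h1
    rw [hcard] at h3
    have h4 : 0 < (H.filter fun v => f v = 0 ∧ g v = 0).card := by
      by_contra h0
      rw [show (H.filter fun v => f v = 0 ∧ g v = 0).card = 0 by omega] at h1
      push_cast at h1
      nlinarith
    obtain ⟨v, hv⟩ := Finset.card_pos.1 h4
    exact ⟨v, (Finset.mem_filter.1 hv).1, (Finset.mem_filter.1 hv).2⟩
  have hkerdim := Module.Dual.finrank_ker_add_one_of_ne_zero hf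
  have : Nontrivial f.ker := Module.nontrivial_of_finrank_pos (R := F) (by omega)
  let H' : Finset f.ker := Finset.univ.filter fun v => (v : V) ∈ H
  have hH' : ∀ v, v ∈ H' ↔ (v : V) ∈ H := fun v => by simp [H']
  have hsmul : ∀ (c : F) (v : f.ker), c ≠ 0 → v ∈ H' → c • v ∈ H' := by
    intro c v hc hv
    rw [hH', hH] at hv ⊢
    exact ⟨smul_ne_zero hc hv.1, fun l hl h => hv.2 l hl ((l.smul_mem_iff hc).1 h)⟩
  have hcard' : H'.card ≤ (q - 1) * (q + k + 1) := by
    have h1 : H'.card ≤ (H.filter fun v => f v = 0).card := by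
      refine Finset.card_le_card_of_injOn Subtype.val ?_ Subtype.val_injective.injOn
      intro v hv
      exact Finset.mem_filter.2 ⟨(hH' v).1 hv, v.2⟩
    refine h1.trans ?_
    have h2 := hHker f hf
    rw [hfx] at h2
    zify
    rw [h2, Nat.cast_sub (by omega)]
    push_cast
    exact (by ring : _ = _).le
  have hblock : ∀ g : Module.Dual F f.ker, g ≠ 0 → ∃ v ∈ H', g v = 0 := by
    intro g hg
    obtain ⟨g', rfl⟩ := LinearMap.exists_extend g
    obtain ⟨v, hv, h1, h2⟩ := hmeet g' (by
      rintro ⟨c, rfl⟩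
      apply hg
      ext v
      simp)
    exact ⟨⟨v, h1⟩, (hH' _).2 hv, h2⟩
  obtain ⟨W, hW, hWH⟩ := exists_plane_subset_of_blocking hp hcard hn hn3 hk (by simp [hH', hH])
    hsmul hcard' hblock
  refine ⟨W.map f.ker.subtype, ?_, fun l hl => ?_⟩
  · rw [Submodule.finrank_map_subtype_eq, hW]
  · rw [Submodule.eq_bot_iff]
    rintro v ⟨hv, hvl⟩
    obtain ⟨w, hw, rfl⟩ := Submodule.mem_map.1 hv
    by_contra h0
    have h1 := hWH w hw (by rintro rfl; simp at h0)
    exact ((hH w).1 ((hH' w).1 h1)).2 l hl hvl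

theorem lacunary_bound_of_lt {p q k : ℕ}
    (h : (k : ℝ) < (if p ≤ 3 then (2 : ℝ) ^ (-(1 / 3 : ℝ)) else 1) * (q : ℝ) ^ ((2 : ℝ) / 3)) :
    (if p ≤ 3 then 2 else 1) * k ^ 3 < q ^ 2 := by
  have hq : ((q : ℝ) ^ ((2 : ℝ) / 3)) ^ 3 = (q : ℝ) ^ 2 := by
    rw [← Real.rpow_natCast, ← Real.rpow_mul (Nat.cast_nonneg q), ← Real.rpow_natCast]
    norm_num
  have h2 : ((2 : ℝ) ^ (-(1 / 3 : ℝ))) ^ 3 = 2⁻¹ := by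
    rw [← Real.rpow_natCast, ← Real.rpow_mul zero_le_two, ← Real.rpow_neg_one]
    norm_num
  have h3 := pow_lt_pow_left₀ h (Nat.cast_nonneg k) three_ne_zero
  rw [mul_pow, hq] at h3
  split_ifs at h3 ⊢
  · rw [h2] at h3
    have : (2 : ℝ) * k ^ 3 < q ^ 2 := by linarith
    exact_mod_cast this
  · rw [one_pow, one_mul] at h3
    rw [one_mul]
    exact_mod_cast h3



/-- (Blokhuis) Let q = p^h with p prime, h odd, h > 2, and N ≥ 3 odd. A maximal
partial line spread of PG(N,q) of deficiency δ > 0 satisfies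
δ ≥ c_p * q^(2/3) + 1, where c_2 = c_3 = 2^(-1/3) and c_p = 1 for p > 3. -/
theorem stmt18 (F : Type*) [Field F] [Fintype F] (q p h : ℕ)
    (hq : Fintype.card F = q) (hp : p.Prime) (hhodd : Odd h) (hh2 : 2 < h)
    (hph : q = p ^ h) (N : ℕ) (hN3 : 3 ≤ N) (hNodd : Odd N)
    (S : Set (Submodule F (Fin (N + 1) → F)))
    (hS : IsMaximalPartialLineSpread F (N + 1) S)
    (δ : ℕ) (hδpos : 0 < δ)
    (hdef : S.ncard + δ = (q ^ (N + 1) - 1) / (q ^ 2 - 1)) :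
    (if p ≤ 3 then (2 : ℝ) ^ (-(1 / 3 : ℝ)) else 1) * (q : ℝ) ^ ((2 : ℝ) / 3) + 1
      ≤ (δ : ℝ) := by
  by_contra! hlt
  obtain ⟨k, rfl⟩ : ∃ k, δ = k + 1 := ⟨δ - 1, by omega⟩
  obtain ⟨e, rfl⟩ : ∃ e, N = 2 * e + 3 := by
    obtain ⟨m, rfl⟩ := hNodd
    exact ⟨m - 1, by omega⟩
  have hk : (if p ≤ 3 then 2 else 1) * k ^ 3 < q ^ 2 :=
    lacunary_bound_of_lt (by push_cast at hlt; linarith)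
  have hq1 : 1 < q := hq ▸ Fintype.one_lt_card
  have hq2 : 1 < q ^ 2 := one_lt_pow₀ hq1 two_ne_zero
  obtain ⟨t, ht⟩ : q ^ 2 - 1 ∣ q ^ (2 * e) - 1 := by
    simpa [pow_mul] using Nat.sub_dvd_pow_sub_pow (q ^ 2) 1 e
  have htz : (q : ℤ) ^ (2 * e) = ((q : ℤ) ^ 2 - 1) * t + 1 := by
    have h1 : 1 ≤ q ^ (2 * e) := Nat.one_le_pow _ _ (by omega)
    zify [h1, hq2.le] at ht
    linarith
  have hdiv : (q ^ (2 * e + 3 + 1) - 1) / (q ^ 2 - 1) = q ^ 2 * (q ^ 2 * t + 1) + 1 := by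
    refine Nat.div_eq_of_eq_mul_right (by omega) ?_
    have h1 : 1 ≤ q ^ (2 * e + 3 + 1) := Nat.one_le_pow _ _ (by omega)
    zify [h1, hq2.le]
    rw [show 2 * e + 3 + 1 = 2 * e + 4 by ring, pow_add, htz]
    ring
  have hfin : S.Finite := Set.toFinite S
  obtain ⟨W, hW, hWS⟩ := exists_plane_disjoint_of_small_deficiency (F := F) (k := k) (e := e)
    (t := t) (S := hfin.toFinset) hp (hq.trans hph) hhodd hh2 (hph ▸ hk) (by simp)
    (by rw [← hph, htz]) (fun l hl => hS.1.1 l (hfin.mem_toFinset.1 hl))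
    (fun l hl l' hl' => hS.1.2 l (hfin.mem_toFinset.1 hl) l' (hfin.mem_toFinset.1 hl')) (by
      rw [← hph, ← Set.ncard_eq_toFinset_card S hfin]
      rw [hdiv] at hdef
      exact_mod_cast hdef)
  obtain ⟨l, hl, hne⟩ := hS.2 W hW
  exact hne (hWS l (hfin.mem_toFinset.2 hl))
end
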